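/- arXiv:0709.0117 — 5 statements merged into one kernel-verified Lean document; each statement's English description precedes it below -/
import Mathlib

section
/- Let f, g : ℂ^n → ℂ be polynomial functions with f(0)=g(0)=0, each having an isolated singularity at the origin, and assume the z₁-axis is not contained in either tangent cone C(V_f), C(V_g) (i.e. the initial homogeneous terms of f and g do not vanish identically on the z₁-axis). Suppose there exist a germ of homeomorphism φ : (ℂ^n,0) → (ℂ^n,0) with inverse ψ, positive real constants A, B, C, D, and two sequences (w_m) and (w'_m) of nonzero points on the z₁-axis converging to the origin such that: (i) |ψ(w'_m)| ≤ A|w'_m| and |φ(w_m)| ≤ B|w_m| for all m, and (ii) C|f(w_m)| ≤ |g(φ(w_m))| and D|g(w'_m)| ≤ |f(ψ(w'_m))| for all m. Then the algebraic multiplicities of f and g are equal: m_f = m_g. -/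
open scoped Topology

set_option synthInstance.maxHeartbeats 1000000
set_option maxHeartbeats 1000000

noncomputable section

/-- `ℂⁿ` with the Euclidean norm. -/
abbrev En (n : ℕ) := EuclideanSpace ℂ (Fin n)

instance germAlgebra {α : Type*} (l : Filter α) : Algebra ℂ (Filter.Germ l ℂ) :=
  ((Filter.Germ.coeRingHom l).comp (Pi.constRingHom α ℂ)).toAlgebra

/-- The ring `𝒪ₙ` of germs at `0` of holomorphic functions on `ℂⁿ`. -/
def AnalyticGerms (n : ℕ) : Subalgebra ℂ ((𝓝 (0 : En n)).Germ ℂ) where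
  carrier := {g | ∃ f : En n → ℂ, AnalyticAt ℂ f 0 ∧ g = (f : (𝓝 (0 : En n)).Germ ℂ)}
  add_mem' := by
    rintro a b ⟨f, hf, rfl⟩ ⟨g, hg, rfl⟩
    exact ⟨f + g, hf.add hg, rfl⟩
  mul_mem' := by
    rintro a b ⟨f, hf, rfl⟩ ⟨g, hg, rfl⟩
    exact ⟨f * g, hf.mul hg, rfl⟩
  algebraMap_mem' := fun c => ⟨fun _ => c, analyticAt_const, rfl⟩

/-- The germ at `0` of the `i`-th partial derivative `∂f/∂zᵢ` of `f`. -/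
def partialGerm {n : ℕ} (f : En n → ℂ) (i : Fin n) : (𝓝 (0 : En n)).Germ ℂ :=
  (↑(fun z => fderiv ℂ f z (EuclideanSpace.single i 1)) : (𝓝 (0 : En n)).Germ ℂ)

/-- The Jacobian ideal `⟨∂f/∂z₁, …, ∂f/∂zₙ⟩` of `f` in the ring `𝒪ₙ` of holomorphic
germs at `0`. -/
def jacobianIdeal {n : ℕ} (f : En n → ℂ) : Ideal (AnalyticGerms n) :=
  Ideal.span {g : AnalyticGerms n | ∃ i : Fin n, (g : (𝓝 (0 : En n)).Germ ℂ) = partialGerm f i}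

/-- The Milnor number `μ_f` of `f` at the origin: the complex dimension of
`𝒪ₙ/⟨∂f/∂z₁, …, ∂f/∂zₙ⟩`. -/
def milnorNumber {n : ℕ} (f : En n → ℂ) : ℕ :=
  Module.finrank ℂ ((AnalyticGerms n) ⧸ jacobianIdeal f)

/-- `f` has algebraic multiplicity `ν` with initial homogeneous term `P`:
in the Taylor expansion `f = f_ν + f_{ν+1} + ⋯` of `f` at `0`, the homogeneous
components of degree `< ν` vanish and the one of degree `ν` is `P ≠ 0`. -/
def HasInitialTerm {n : ℕ} (f : En n → ℂ) (ν : ℕ) (P : En n → ℂ) : Prop :=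
  ∃ p : FormalMultilinearSeries ℂ (En n) ℂ, HasFPowerSeriesAt f p 0 ∧
    (∀ k < ν, ∀ z : En n, (p k fun _ => z) = 0) ∧
    (∀ z : En n, P z = p ν fun _ => z) ∧ P ≠ 0

/-- The origin is an isolated singularity of `f`: the gradient of `f` vanishes at `0`
and at no other point of some neighborhood of `0`. -/
def IsolatedSingularityAt0 {n : ℕ} (f : En n → ℂ) : Prop :=
  fderiv ℂ f 0 = 0 ∧ ∃ U ∈ 𝓝 (0 : En n), ∀ z ∈ U, z ≠ 0 → fderiv ℂ f z ≠ 0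

/-- The germs at `0` of the hypersurfaces `V_f = f⁻¹(0)` and `V_g = g⁻¹(0)` are
topologically equisingular: some homeomorphism between neighborhoods of `0`
fixes `0` and sends `f⁻¹(0) ∩ U` onto `g⁻¹(0) ∩ U'`. -/
def TopEquisingular {n : ℕ} (f g : En n → ℂ) : Prop :=
  ∃ U U' : Set (En n), U ∈ 𝓝 (0 : En n) ∧ U' ∈ 𝓝 (0 : En n) ∧
    ∃ φ ψ : En n → En n, φ 0 = 0 ∧ ContinuousOn φ U ∧ ContinuousOn ψ U' ∧
      Set.MapsTo φ U U' ∧ Set.MapsTo ψ U' U ∧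
      (∀ z ∈ U, ψ (φ z) = z) ∧ (∀ z ∈ U', φ (ψ z) = z) ∧
      φ '' (f ⁻¹' {0} ∩ U) = g ⁻¹' {0} ∩ U'

/-- `φ` is a germ of homeomorphism of `(X, 0)`: a homeomorphism between neighborhoods
of `0` fixing `0`. -/
def IsGermHomeoAt0 {X : Type*} [TopologicalSpace X] [Zero X] (φ : X → X) : Prop :=
  ∃ U V : Set X, U ∈ 𝓝 (0 : X) ∧ V ∈ 𝓝 (0 : X) ∧ φ 0 = 0 ∧ ContinuousOn φ U ∧
    Set.MapsTo φ U V ∧ ∃ ψ : X → X, ContinuousOn ψ V ∧ Set.MapsTo ψ V U ∧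
      (∀ x ∈ U, ψ (φ x) = x) ∧ (∀ y ∈ V, φ (ψ y) = y)

/-- `f` and `g` are topologically right-left equivalent:
`f = ψ ∘ g ∘ φ` near `0` for germs of homeomorphisms `φ` of `(ℂⁿ,0)` and `ψ` of `(ℂ,0)`. -/
def TopRightLeftEquiv {n : ℕ} (f g : En n → ℂ) : Prop :=
  ∃ φ : En n → En n, ∃ ψ : ℂ → ℂ, IsGermHomeoAt0 φ ∧ IsGermHomeoAt0 ψ ∧
    ∀ᶠ z in 𝓝 (0 : En n), f z = ψ (g (φ z))

/-- Evaluation of a polynomial in `n` variables at a point of `ℂⁿ`. -/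
def evalE {n : ℕ} (f : MvPolynomial (Fin n) ℂ) : En n → ℂ :=
  fun z => MvPolynomial.eval (fun i => z i) f
/-- A polynomial all of whose monomials have degree at least `N` is `O(‖z‖ ^ N)` at the origin. -/
lemma exists_norm_evalE_le {n : ℕ} (p : MvPolynomial (Fin n) ℂ) (N : ℕ)
    (hp : ∀ j < N, MvPolynomial.homogeneousComponent j p = 0) :
    ∃ K : ℝ, ∀ z : En n, ‖z‖ ≤ 1 → ‖evalE p z‖ ≤ K * ‖z‖ ^ N := by
  refine ⟨∑ d ∈ p.support, ‖p.coeff d‖, fun z hz => ?_⟩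
  rw [evalE, MvPolynomial.eval_eq, Finset.sum_mul]
  refine norm_sum_le_of_le _ fun d hd => ?_
  have hdN : N ≤ d.degree := by
    by_contra! h
    have h0 := congrArg (MvPolynomial.coeff d) (hp _ h)
    rw [MvPolynomial.coeff_homogeneousComponent, if_pos rfl, MvPolynomial.coeff_zero] at h0
    exact MvPolynomial.mem_support_iff.mp hd h0
  rw [norm_mul, norm_prod]
  refine mul_le_mul_of_nonneg_left ?_ (norm_nonneg _)
  calc ∏ i ∈ d.support, ‖z i ^ d i‖ ≤ ∏ i ∈ d.support, ‖z‖ ^ d i := by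
        refine Finset.prod_le_prod (fun _ _ => norm_nonneg _) fun i _ => ?_
        rw [norm_pow]
        exact pow_le_pow_left₀ (norm_nonneg _) (PiLp.norm_apply_le z i) _
    _ = ‖z‖ ^ d.degree := by rw [Finset.prod_pow_eq_pow_sum, Finsupp.degree_apply]
    _ ≤ ‖z‖ ^ N := pow_le_pow_of_le_one (norm_nonneg _) hz hdN

lemma evalE_smul_of_isHomogeneous {n k : ℕ} {p : MvPolynomial (Fin n) ℂ}
    (hp : p.IsHomogeneous k) (t : ℂ) (z : En n) : evalE p (t • z) = t ^ k * evalE p z := by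
  simp only [evalE, MvPolynomial.eval_eq, Finset.mul_sum]
  refine Finset.sum_congr rfl fun d hd => ?_
  have hdk : ∑ i ∈ d.support, d i = k := by
    rw [← Finsupp.degree_apply]
    rw [Finsupp.degree_eq_weight_one]
    exact hp (MvPolynomial.mem_support_iff.mp hd)
  simp only [PiLp.smul_apply, smul_eq_mul, mul_pow, Finset.prod_mul_distrib,
    Finset.prod_pow_eq_pow_sum, hdk]
  ring

/-- If `e` is not in the tangent cone of `f`, and `|f|` along a sequence of points of the line
through `e` is dominated by `|g|` at points of comparable norm, then the multiplicity of `g` is at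
most that of `f`. -/
lemma multiplicity_le_of_norm_le {n : ℕ} (f g : MvPolynomial (Fin n) ℂ) (k l : ℕ) (e : En n)
    (he : ‖e‖ = 1)
    (hf : ∀ j < k, MvPolynomial.homogeneousComponent j f = 0)
    (hg : ∀ j < l, MvPolynomial.homogeneousComponent j g = 0)
    (hax : ∃ t : ℂ, evalE (MvPolynomial.homogeneousComponent k f) (t • e) ≠ 0)
    (B C : ℝ) (hC : 0 < C) (w v : ℕ → En n)
    (hw : ∀ m, ∃ t : ℂ, t ≠ 0 ∧ w m = t • e)
    (hwlim : Filter.Tendsto w Filter.atTop (𝓝 0))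
    (hv : ∀ m, ‖v m‖ ≤ B * ‖w m‖)
    (hfg : ∀ m, C * ‖evalE f (w m)‖ ≤ ‖evalE g (v m)‖) : l ≤ k := by
  by_contra! hkl
  set F := MvPolynomial.homogeneousComponent k f with hF
  have hFhom : F.IsHomogeneous k := MvPolynomial.homogeneousComponent_isHomogeneous k f
  have ha : 0 < ‖evalE F e‖ := by
    obtain ⟨t, ht⟩ := hax
    rw [evalE_smul_of_isHomogeneous hFhom] at ht
    exact norm_pos_iff.mpr (right_ne_zero_of_mul ht)
  obtain ⟨K, hK⟩ := exists_norm_evalE_le (f - F) (k + 1) fun j hj => by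
    rw [map_sub, MvPolynomial.homogeneousComponent_of_mem hFhom]
    rcases (Nat.lt_succ_iff.mp hj).lt_or_eq with h | rfl
    · rw [hf j h, if_neg h.ne, sub_zero]
    · rw [if_pos rfl, sub_self]
  obtain ⟨L, hL⟩ := exists_norm_evalE_le g (k + 1) fun j hj => hg j (by omega)
  have hr : Filter.Tendsto (fun m => ‖w m‖) Filter.atTop (𝓝 0) := by
    simpa using hwlim.norm
  have hBr : Filter.Tendsto (fun m => B * ‖w m‖) Filter.atTop (𝓝 0) := by
    simpa using hr.const_mul B
  have hlim : Filter.Tendsto (fun m => (C * K + |L| * B ^ (k + 1)) * ‖w m‖) Filter.atTop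
      (𝓝 0) := by
    simpa using hr.const_mul (C * K + |L| * B ^ (k + 1))
  refine (mul_pos hC ha).not_ge (ge_of_tendsto hlim ?_)
  filter_upwards [hr.eventually_le_const one_pos, hBr.eventually_le_const one_pos] with m hm hBm
  obtain ⟨t, ht, hwt⟩ := hw m
  have hnorm : ‖w m‖ = ‖t‖ := by rw [hwt, norm_smul, he, mul_one]
  have hpos : 0 < ‖w m‖ := by rw [hnorm]; exact norm_pos_iff.mpr ht
  have hsplit : evalE F (w m) = evalE f (w m) - evalE (f - F) (w m) := by simp [evalE]
  have hFw : ‖evalE F (w m)‖ = ‖w m‖ ^ k * ‖evalE F e‖ := by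
    rw [hnorm, hwt, evalE_smul_of_isHomogeneous hFhom, norm_mul, norm_pow]
  have h1 : ‖w m‖ ^ k * ‖evalE F e‖ ≤ ‖evalE f (w m)‖ + K * ‖w m‖ ^ (k + 1) := by
    rw [← hFw, hsplit]
    exact (norm_sub_le _ _).trans (add_le_add_right (hK _ hm) _)
  have h2 : ‖evalE g (v m)‖ ≤ |L| * (B * ‖w m‖) ^ (k + 1) :=
    (hL _ ((hv m).trans hBm)).trans <| mul_le_mul (le_abs_self L)
      (pow_le_pow_left₀ (norm_nonneg _) (hv m) _) (by positivity) (abs_nonneg L)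
  refine le_of_mul_le_mul_right ?_ (pow_pos hpos k)
  calc C * ‖evalE F e‖ * ‖w m‖ ^ k = C * (‖w m‖ ^ k * ‖evalE F e‖) := by ring
    _ ≤ C * (‖evalE f (w m)‖ + K * ‖w m‖ ^ (k + 1)) := mul_le_mul_of_nonneg_left h1 hC.le
    _ = C * ‖evalE f (w m)‖ + C * K * ‖w m‖ ^ (k + 1) := by ring
    _ ≤ |L| * (B * ‖w m‖) ^ (k + 1) + C * K * ‖w m‖ ^ (k + 1) :=
        add_le_add_left ((hfg m).trans h2) _
    _ = (C * K + |L| * B ^ (k + 1)) * ‖w m‖ * ‖w m‖ ^ k := by ring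

theorem zariski_special_sequences {n : ℕ} (hn : 0 < n)
    (f g : MvPolynomial (Fin n) ℂ)
    (hf0 : MvPolynomial.eval (fun _ => (0:ℂ)) f = 0)
    (hg0 : MvPolynomial.eval (fun _ => (0:ℂ)) g = 0)
    (hfsing : IsolatedSingularityAt0 (evalE f)) (hgsing : IsolatedSingularityAt0 (evalE g))
    -- `k` and `l` are the algebraic multiplicities of `f` and `g`
    (k l : ℕ)
    (hfk : MvPolynomial.homogeneousComponent k f ≠ 0)
    (hfk' : ∀ j < k, MvPolynomial.homogeneousComponent j f = 0)
    (hgl : MvPolynomial.homogeneousComponent l g ≠ 0)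
    (hgl' : ∀ j < l, MvPolynomial.homogeneousComponent j g = 0)
    -- the `z₁`-axis is not contained in the tangent cones `C(V_f)`, `C(V_g)`
    (haxf : ∃ t : ℂ, evalE (MvPolynomial.homogeneousComponent k f)
      (t • EuclideanSpace.single (⟨0, hn⟩ : Fin n) (1:ℂ)) ≠ 0)
    (haxg : ∃ t : ℂ, evalE (MvPolynomial.homogeneousComponent l g)
      (t • EuclideanSpace.single (⟨0, hn⟩ : Fin n) (1:ℂ)) ≠ 0)
    -- a germ of homeomorphism `φ` of `(ℂⁿ,0)` with inverse `ψ`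
    (U U' : Set (En n)) (hU : U ∈ 𝓝 (0 : En n)) (hU' : U' ∈ 𝓝 (0 : En n))
    (φ ψ : En n → En n) (hφ0 : φ 0 = 0)
    (hφc : ContinuousOn φ U) (hψc : ContinuousOn ψ U')
    (hφm : Set.MapsTo φ U U') (hψm : Set.MapsTo ψ U' U)
    (hψφ : ∀ z ∈ U, ψ (φ z) = z) (hφψ : ∀ z ∈ U', φ (ψ z) = z)
    (A B C D : ℝ) (hA : 0 < A) (hB : 0 < B) (hC : 0 < C) (hD : 0 < D)
    -- two sequences of nonzero points of the `z₁`-axis converging to the origin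
    (w w' : ℕ → En n)
    (hw : ∀ m, ∃ t : ℂ, t ≠ 0 ∧ w m = t • EuclideanSpace.single (⟨0, hn⟩ : Fin n) (1:ℂ))
    (hw' : ∀ m, ∃ t : ℂ, t ≠ 0 ∧ w' m = t • EuclideanSpace.single (⟨0, hn⟩ : Fin n) (1:ℂ))
    (hwU : ∀ m, w m ∈ U) (hw'U : ∀ m, w' m ∈ U')
    (hwlim : Filter.Tendsto w Filter.atTop (𝓝 (0 : En n)))
    (hw'lim : Filter.Tendsto w' Filter.atTop (𝓝 (0 : En n)))
    -- condition (i)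
    (hiψ : ∀ m, ‖ψ (w' m)‖ ≤ A * ‖w' m‖)
    (hiφ : ∀ m, ‖φ (w m)‖ ≤ B * ‖w m‖)
    -- condition (ii)
    (hiif : ∀ m, C * ‖evalE f (w m)‖ ≤ ‖evalE g (φ (w m))‖)
    (hiig : ∀ m, D * ‖evalE g (w' m)‖ ≤ ‖evalE f (ψ (w' m))‖) :
    k = l := by
  have he : ‖(EuclideanSpace.single (⟨0, hn⟩ : Fin n) (1 : ℂ) : En n)‖ = 1 := by simp
  exact le_antisymm
    (multiplicity_le_of_norm_le g f l k _ he hgl' hfk' haxg A D hD w' (fun m => ψ (w' m))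
      hw' hw'lim hiψ hiig)
    (multiplicity_le_of_norm_le f g k l _ he hfk' hgl' haxf B C hC w (fun m => φ (w m))
      hw hwlim hiφ hiif)
end
end

section
/- Let f, g : ℂ^n → ℂ be polynomial functions with f(0)=g(0)=0 and algebraic multiplicities k and l respectively, and assume the initial homogeneous term f_k of f does not vanish at e₁=(1,0,…,0). Suppose there exist a map φ defined on a neighborhood of 0 in ℂ^n with values in ℂ^n, positive constants B and C, and a sequence w_m = (t_m,0,…,0) with t_m ≠ 0 and t_m → 0, such that |φ(w_m)| ≤ B|w_m| and C|f(w_m)| ≤ |g(φ(w_m))| for all m. Then l ≤ k. -/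
open scoped Topology

set_option synthInstance.maxHeartbeats 1000000
set_option maxHeartbeats 1000000

noncomputable section

/-- A polynomial all of whose homogeneous components of degree `< l` vanish is `O(‖z‖ ^ l)` on the
unit ball. -/
lemma exists_norm_evalE_le_of_homogeneousComponent_eq_zero {n : ℕ} (g : MvPolynomial (Fin n) ℂ)
    (l : ℕ) (hg : ∀ j < l, MvPolynomial.homogeneousComponent j g = 0) :
    ∃ D : ℝ, 0 ≤ D ∧ ∀ z : En n, ‖z‖ ≤ 1 → ‖evalE g z‖ ≤ D * ‖z‖ ^ l := by
  refine ⟨∑ d ∈ g.support, ‖g.coeff d‖, Finset.sum_nonneg fun _ _ => norm_nonneg _,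
    fun z hz => ?_⟩
  rw [evalE, MvPolynomial.eval_eq, Finset.sum_mul]
  refine (norm_sum_le _ _).trans (Finset.sum_le_sum fun d hd => ?_)
  rw [norm_mul, norm_prod]
  refine mul_le_mul_of_nonneg_left ?_ (norm_nonneg _)
  have hl : l ≤ ∑ i, d i := by
    by_contra! hlt
    have hc := congrArg (MvPolynomial.coeff d) (hg _ hlt)
    rw [MvPolynomial.coeff_homogeneousComponent, if_pos (Finsupp.degree_eq_sum d),
      MvPolynomial.coeff_zero] at hc
    exact MvPolynomial.mem_support_iff.1 hd hc
  calc ∏ i ∈ d.support, ‖z i ^ d i‖ ≤ ∏ i ∈ d.support, ‖z‖ ^ d i := by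
        refine Finset.prod_le_prod (fun _ _ => norm_nonneg _) fun i _ => ?_
        rw [norm_pow]
        gcongr
        exact PiLp.norm_apply_le z i
    _ = ‖z‖ ^ ∑ i, d i := by
        rw [Finset.prod_pow_eq_pow_sum]
        congr 1
        exact (Finsupp.degree_apply d).symm.trans (Finsupp.degree_eq_sum d)
    _ ≤ ‖z‖ ^ l := pow_le_pow_of_le_one (norm_nonneg _) hz hl

theorem multiplicity_le_of_sequence {n : ℕ} (hn : 0 < n)
    (f g : MvPolynomial (Fin n) ℂ)
    (hf0 : MvPolynomial.eval (fun _ => (0:ℂ)) f = 0)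
    (hg0 : MvPolynomial.eval (fun _ => (0:ℂ)) g = 0)
    -- `k` and `l` are the algebraic multiplicities of `f` and `g`
    (k l : ℕ)
    (hfk : MvPolynomial.homogeneousComponent k f ≠ 0)
    (hfk' : ∀ j < k, MvPolynomial.homogeneousComponent j f = 0)
    (hgl : MvPolynomial.homogeneousComponent l g ≠ 0)
    (hgl' : ∀ j < l, MvPolynomial.homogeneousComponent j g = 0)
    -- the initial homogeneous term of `f` does not vanish at `e₁ = (1,0,…,0)`
    (he1 : evalE (MvPolynomial.homogeneousComponent k f)
      (EuclideanSpace.single (⟨0, hn⟩ : Fin n) (1:ℂ)) ≠ 0)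
    -- a map `φ` defined on a neighborhood of `0`
    (V : Set (En n)) (hV : V ∈ 𝓝 (0 : En n)) (φ : En n → En n)
    (B C : ℝ) (hB : 0 < B) (hC : 0 < C)
    -- a sequence `w m = (t m, 0, …, 0)` with `t m ≠ 0` and `t m → 0`
    (t : ℕ → ℂ) (ht : ∀ m, t m ≠ 0) (htlim : Filter.Tendsto t Filter.atTop (𝓝 (0:ℂ)))
    (hwV : ∀ m, t m • EuclideanSpace.single (⟨0, hn⟩ : Fin n) (1:ℂ) ∈ V)
    (h1 : ∀ m, ‖φ (t m • EuclideanSpace.single (⟨0, hn⟩ : Fin n) (1:ℂ))‖ ≤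
      B * ‖t m • EuclideanSpace.single (⟨0, hn⟩ : Fin n) (1:ℂ)‖)
    (h2 : ∀ m, C * ‖evalE f (t m • EuclideanSpace.single (⟨0, hn⟩ : Fin n) (1:ℂ))‖ ≤
      ‖evalE g (φ (t m • EuclideanSpace.single (⟨0, hn⟩ : Fin n) (1:ℂ)))‖) :
    l ≤ k := by
  by_contra! hkl
  set e : En n := EuclideanSpace.single (⟨0, hn⟩ : Fin n) (1:ℂ) with he
  set a := evalE (MvPolynomial.homogeneousComponent k f) e with ha
  have hw : ∀ m, ‖t m • e‖ = ‖t m‖ := fun m => by simp [norm_smul, he]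
  obtain ⟨D, hD, hgD⟩ := exists_norm_evalE_le_of_homogeneousComponent_eq_zero g l hgl'
  obtain ⟨D', hD', hfD⟩ := exists_norm_evalE_le_of_homogeneousComponent_eq_zero
    (f - MvPolynomial.homogeneousComponent k f) (k + 1) (fun j hj => by
      rw [map_sub, MvPolynomial.homogeneousComponent_of_mem
        (MvPolynomial.homogeneousComponent_mem k f)]
      split_ifs with h
      · rw [h, sub_self]
      · rw [hfk' j (by omega), sub_zero])
  have htn : Filter.Tendsto (fun m => ‖t m‖) Filter.atTop (𝓝 0) := by
    simpa using htlim.norm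
  have hBt : Filter.Tendsto (fun m => B * ‖t m‖) Filter.atTop (𝓝 0) := by
    simpa using htn.const_mul B
  have hle : ∀ᶠ m in Filter.atTop, C * ‖a‖ ≤ (C * D' + D * B ^ l) * ‖t m‖ := by
    filter_upwards [htn.eventually_le_const one_pos, hBt.eventually_le_const one_pos] with m hm hm'
    have hφ : ‖φ (t m • e)‖ ≤ B * ‖t m‖ := hw m ▸ h1 m
    have hg : ‖evalE g (φ (t m • e))‖ ≤ D * B ^ l * ‖t m‖ ^ (k + 1) :=
      calc _ ≤ D * ‖φ (t m • e)‖ ^ l := hgD _ (hφ.trans hm')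
        _ ≤ D * (B * ‖t m‖) ^ l := by gcongr
        _ = D * B ^ l * ‖t m‖ ^ l := by ring
        _ ≤ D * B ^ l * ‖t m‖ ^ (k + 1) := mul_le_mul_of_nonneg_left
          (pow_le_pow_of_le_one (norm_nonneg _) hm hkl) (by positivity)
    have hf : ‖t m‖ ^ k * ‖a‖ ≤ ‖evalE f (t m • e)‖ + D' * ‖t m‖ ^ (k + 1) := by
      have hr := hfD (t m • e) ((hw m).trans_le hm)
      rw [hw] at hr
      have hsub : evalE (f - MvPolynomial.homogeneousComponent k f) (t m • e) =
          evalE f (t m • e) - t m ^ k * a := by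
        rw [ha, ← evalE_smul_of_isHomogeneous (MvPolynomial.homogeneousComponent_isHomogeneous k f)]
        simp [evalE]
      rw [hsub] at hr
      have hn' := norm_sub_norm_le (t m ^ k * a) (evalE f (t m • e))
      rw [norm_sub_rev, norm_mul, norm_pow] at hn'
      linarith
    have hpos : 0 < ‖t m‖ ^ k := pow_pos (norm_pos_iff.2 (ht m)) k
    refine le_of_mul_le_mul_left ?_ hpos
    calc ‖t m‖ ^ k * (C * ‖a‖) = C * (‖t m‖ ^ k * ‖a‖) := by ring
      _ ≤ C * (‖evalE f (t m • e)‖ + D' * ‖t m‖ ^ (k + 1)) := by gcongr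
      _ = C * ‖evalE f (t m • e)‖ + C * D' * ‖t m‖ ^ (k + 1) := by ring
      _ ≤ D * B ^ l * ‖t m‖ ^ (k + 1) + C * D' * ‖t m‖ ^ (k + 1) := by
        exact add_le_add_left ((h2 m).trans hg) _
      _ = ‖t m‖ ^ k * ((C * D' + D * B ^ l) * ‖t m‖) := by ring
  have hlim : Filter.Tendsto (fun m => (C * D' + D * B ^ l) * ‖t m‖) Filter.atTop (𝓝 0) := by
    simpa using htn.const_mul (C * D' + D * B ^ l)
  exact absurd (ge_of_tendsto hlim hle) (not_le.2 (mul_pos hC (norm_pos_iff.2 he1)))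
end
end

section
/- Let f, g : (ℂ^n,0) → (ℂ,0) be germs of holomorphic functions with isolated singularity at the origin. Suppose there exist a germ of homeomorphism φ : (ℂ^n,0) → (ℂ^n,0) and positive real constants A, B, C, D such that (1) A|z| ≤ |φ(z)| ≤ B|z| for all z near 0, and (2) C|f(z)| ≤ |g(φ(z))| ≤ D|f(z)| for all z near 0. Then the algebraic multiplicities of f and g are equal: m_f = m_g. -/
open scoped Topology

set_option synthInstance.maxHeartbeats 1000000
set_option maxHeartbeats 1000000

noncomputable section

open Asymptotics

/-- A function of multiplicity `ν` is `O(‖z‖ ^ ν)` at the origin. -/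
theorem HasInitialTerm.isBigO {n : ℕ} {f : En n → ℂ} {ν : ℕ} {P : En n → ℂ}
    (h : HasInitialTerm f ν P) : f =O[𝓝 0] fun z => ‖z‖ ^ ν := by
  obtain ⟨p, hp, hlow, -, -⟩ := h
  refine (hp.isBigO_sub_partialSum_pow ν).congr_left fun z => ?_
  have hz : p.partialSum ν z = 0 :=
    Finset.sum_eq_zero fun k hk => hlow k (Finset.mem_range.mp hk) z
  rw [hz, zero_add, sub_zero]

/-- The multiplicity is the largest order of vanishing at the origin. -/
theorem HasInitialTerm.le_of_isBigO {n : ℕ} {f : En n → ℂ} {ν k : ℕ} {P : En n → ℂ}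
    (h : HasInitialTerm f ν P) (hk : f =O[𝓝 0] fun z => ‖z‖ ^ k) : k ≤ ν := by
  obtain ⟨p, hp, hlow, hP, hP0⟩ := h
  by_contra! hlt
  have hpow : (fun z : En n => ‖z‖ ^ k) =O[𝓝 0] fun z => ‖z‖ ^ (ν + 1) := by
    refine IsBigO.of_bound 1 ?_
    filter_upwards [Metric.closedBall_mem_nhds (0 : En n) one_pos] with z hz
    rw [mem_closedBall_zero_iff] at hz
    simpa using pow_le_pow_of_le_one (norm_nonneg z) hz hlt
  have hsub : (fun z => p ν fun _ => z) =O[𝓝 0] fun z => ‖z‖ ^ (ν + 1) := by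
    refine ((hk.trans hpow).sub (hp.isBigO_sub_partialSum_pow (ν + 1))).congr_left fun z => ?_
    have hz : p.partialSum (ν + 1) z = p ν fun _ => z := by
      rw [FormalMultilinearSeries.partialSum, Finset.sum_range_succ,
        Finset.sum_eq_zero fun k hk => hlow k (Finset.mem_range.mp hk) z, zero_add]
    rw [hz, zero_add, sub_sub_cancel]
  exact hP0 (funext fun z => (hP z).trans (hsub.continuousMultilinearMap_apply_eq_zero z))

theorem comte_milman_trotman {n : ℕ} (f g : En n → ℂ)
    (hf : AnalyticAt ℂ f 0) (hg : AnalyticAt ℂ g 0)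
    (hf0 : f 0 = 0) (hg0 : g 0 = 0)
    (hfsing : IsolatedSingularityAt0 f) (hgsing : IsolatedSingularityAt0 g)
    -- `ν` and `ν'` are the algebraic multiplicities of `f` and `g`
    (ν ν' : ℕ) (P Q : En n → ℂ)
    (hfi : HasInitialTerm f ν P) (hgi : HasInitialTerm g ν' Q)
    -- a germ of homeomorphism `φ` of `(ℂⁿ,0)`
    (U U' : Set (En n)) (hU : U ∈ 𝓝 (0 : En n)) (hU' : U' ∈ 𝓝 (0 : En n))
    (φ ψ : En n → En n) (hφ0 : φ 0 = 0)
    (hφc : ContinuousOn φ U) (hψc : ContinuousOn ψ U')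
    (hφm : Set.MapsTo φ U U') (hψm : Set.MapsTo ψ U' U)
    (hψφ : ∀ z ∈ U, ψ (φ z) = z) (hφψ : ∀ z ∈ U', φ (ψ z) = z)
    (A B C D : ℝ) (hA : 0 < A) (hB : 0 < B) (hC : 0 < C) (hD : 0 < D)
    -- condition (1), for all `z` near `0`
    (h1 : ∀ᶠ z in 𝓝 (0 : En n), A * ‖z‖ ≤ ‖φ z‖ ∧ ‖φ z‖ ≤ B * ‖z‖)
    -- condition (2), for all `z` near `0`
    (h2 : ∀ᶠ z in 𝓝 (0 : En n), C * ‖f z‖ ≤ ‖g (φ z)‖ ∧ ‖g (φ z)‖ ≤ D * ‖f z‖) :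
    ν = ν' := by
  have hU0 : (0 : En n) ∈ U := mem_of_mem_nhds hU
  have hψ0 : ψ 0 = 0 := by simpa only [hφ0] using hψφ 0 hU0
  have hφt : Filter.Tendsto φ (𝓝 0) (𝓝 0) := by
    simpa only [hφ0] using (hφc.continuousAt hU).tendsto
  have hψt : Filter.Tendsto ψ (𝓝 0) (𝓝 0) := by
    simpa only [hψ0] using (hψc.continuousAt hU').tendsto
  have hφψ' : ∀ᶠ w in 𝓝 (0 : En n), φ (ψ w) = w := by
    filter_upwards [hU'] with w hw using hφψ w hw
  have hφO : φ =O[𝓝 0] fun z => z :=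
    IsBigO.of_bound B (h1.mono fun _ hz => hz.2)
  have hψO : ψ =O[𝓝 0] fun w => w := by
    refine IsBigO.of_bound A⁻¹ ?_
    filter_upwards [hψt.eventually h1, hφψ'] with w hw hw'
    rw [hw'] at hw
    rw [inv_mul_eq_div, le_div_iff₀' hA]
    exact hw.1
  have hfO : f =O[𝓝 0] fun z => g (φ z) := by
    refine IsBigO.of_bound C⁻¹ (h2.mono fun z hz => ?_)
    rw [inv_mul_eq_div, le_div_iff₀' hC]
    exact hz.1
  have hgO : g =O[𝓝 0] fun w => f (ψ w) := by
    refine IsBigO.of_bound D ?_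
    filter_upwards [hψt.eventually h2, hφψ'] with w hw hw'
    rw [hw'] at hw
    exact hw.2
  apply le_antisymm
  · exact hgi.le_of_isBigO <|
      (hgO.trans (hfi.isBigO.comp_tendsto hψt)).trans (hψO.norm_norm.pow ν)
  · exact hfi.le_of_isBigO <|
      (hfO.trans (hgi.isBigO.comp_tendsto hφt)).trans (hφO.norm_norm.pow ν')
end
end

section
/- Let n ≠ 3 and let f : (ℂ^n,0) → (ℂ,0) be a germ of holomorphic function of algebraic multiplicity k whose initial homogeneous term f_k has an isolated singularity at the origin (the partial derivatives of f_k have no common zero other than 0). Then the germ V_f at the origin is topologically equisingular to the germ at the origin of the hypersurface defined by z₁^k + z₂^k + ⋯ + z_n^k. -/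
open scoped Topology

set_option synthInstance.maxHeartbeats 1000000
set_option maxHeartbeats 1000000

noncomputable section

open Set Metric

section Flow

variable {V : Type*} [NormedAddCommGroup V] [NormedSpace ℝ V]

/-- `α` is a trajectory on `[0, 1]` of the time-dependent vector field `v`. -/
def IsTrajectory (v : ℝ → V → V) (α : ℝ → V) : Prop :=
  ∀ t ∈ Icc (0 : ℝ) 1, HasDerivWithinAt α (v t (α t)) (Icc 0 1) t

lemma IsTrajectory.continuousOn {v : ℝ → V → V} {α : ℝ → V} (h : IsTrajectory v α) :
    ContinuousOn α (Icc 0 1) := fun t ht => (h t ht).continuousWithinAt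

lemma IsTrajectory.hasDerivWithinAt_Ici {v : ℝ → V → V} {α : ℝ → V} (h : IsTrajectory v α)
    {t : ℝ} (ht : t ∈ Ico (0 : ℝ) 1) : HasDerivWithinAt α (v t (α t)) (Ici t) t :=
  (h t ⟨ht.1, ht.2.le⟩).mono_of_mem_nhdsWithin (Icc_mem_nhdsGE_of_mem ht)

/-- Trajectories of a Lipschitz vector field separate at most exponentially. -/
lemma IsTrajectory.dist_le {v : ℝ → V → V} (hv : ∀ t ∈ Icc (0 : ℝ) 1, LipschitzWith (1 / 4) (v t))
    {α β : ℝ → V} (hα : IsTrajectory v α) (hβ : IsTrajectory v β) {t : ℝ}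
    (ht : t ∈ Icc (0 : ℝ) 1) : dist (α t) (β t) ≤ 3 / 2 * dist (α 0) (β 0) := by
  have h := dist_le_of_trajectories_ODE_of_mem (s := fun _ => univ)
    (fun t ht => (hv t ⟨ht.1, ht.2.le⟩).lipschitzOnWith) hα.continuousOn
    (fun t ht => hα.hasDerivWithinAt_Ici ht) (fun _ _ => trivial) hβ.continuousOn
    (fun t ht => hβ.hasDerivWithinAt_Ici ht) (fun _ _ => trivial) le_rfl t ht
  refine h.trans ?_
  rw [mul_comm]
  refine mul_le_mul_of_nonneg_right ?_ dist_nonneg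
  have h1 : (((1 / 4 : NNReal) : ℝ) * (t - 0)) ≤ 1 / 4 := by
    push_cast; linarith [ht.2]
  refine (Real.exp_le_exp.2 h1).trans ?_
  have h2 := Real.exp_bound_div_one_sub_of_interval (x := 1 / 4) (by norm_num) (by norm_num)
  refine h2.trans (by norm_num)

lemma isTrajectory_zero {v : ℝ → V → V} (h0 : ∀ t, v t 0 = 0) :
    IsTrajectory v fun _ => 0 := fun t _ => by
  simpa [h0] using hasDerivWithinAt_const t (Icc (0 : ℝ) 1) (0 : V)

lemma IsTrajectory.reverse {v : ℝ → V → V} {α : ℝ → V} (h : IsTrajectory v α) :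
    IsTrajectory (fun t x => -v (1 - t) x) fun t => α (1 - t) := by
  intro t ht
  have ht' : 1 - t ∈ Icc (0 : ℝ) 1 := ⟨by linarith [ht.2], by linarith [ht.1]⟩
  have h1 : HasDerivWithinAt (fun s : ℝ => 1 - s) (-1) (Icc 0 1) t :=
    ((hasDerivAt_id t).const_sub 1).hasDerivWithinAt
  have h2 := (h _ ht').scomp t h1 (fun s hs => ⟨by linarith [hs.2], by linarith [hs.1]⟩)
  simpa [Function.comp_def] using h2

lemma exists_isTrajectory [CompleteSpace V] {v : ℝ → V → V}
    (hv : ∀ t ∈ Icc (0 : ℝ) 1, LipschitzWith (1 / 4) (v t))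
    (hc : ∀ x, ContinuousOn (fun t => v t x) (Icc 0 1)) (h0 : ∀ t, v t 0 = 0) (x : V) :
    ∃ α, α 0 = x ∧ IsTrajectory v α := by
  have hpl : IsPicardLindelof v (tmin := 0) (tmax := 1) ⟨0, by simp⟩ x ‖x‖₊ 0 ‖x‖₊ (1 / 4) :=
    { lipschitzOnWith := fun t ht => (hv t ht).lipschitzOnWith
      continuousOn := fun y _ => hc y
      norm_le := by
        intro t ht y hy
        have h1 := (hv t ht).dist_le_mul y 0
        rw [h0, dist_zero_right, dist_zero_right] at h1
        have h2 : ‖y‖ ≤ ‖x‖ + ‖x‖ := by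
          have := norm_le_norm_add_norm_sub' y x
          rw [mem_closedBall, dist_eq_norm] at hy
          simp only [coe_nnnorm] at hy
          linarith
        push_cast at h1 ⊢
        linarith [norm_nonneg x]
      mul_max_le := by simp }
  exact hpl.exists_eq_forall_mem_Icc_hasDerivWithinAt₀

/-- The time-one map of a Lipschitz vector field vanishing at `0` is a homeomorphism. -/
lemma exists_homeomorph_flow [CompleteSpace V] {v : ℝ → V → V}
    (hv : ∀ t ∈ Icc (0 : ℝ) 1, LipschitzWith (1 / 4) (v t))
    (hc : ∀ x, ContinuousOn (fun t => v t x) (Icc 0 1)) (h0 : ∀ t, v t 0 = 0) :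
    ∃ φ : V ≃ₜ V, φ 0 = 0 ∧ ∀ x, ∃ α, α 0 = x ∧ α 1 = φ x ∧ IsTrajectory v α ∧
      ∀ t ∈ Icc (0 : ℝ) 1, ‖α t‖ ≤ 3 / 2 * ‖x‖ := by
  have hr : ∀ t ∈ Icc (0 : ℝ) 1, 1 - t ∈ Icc (0 : ℝ) 1 := fun t ht =>
    ⟨by linarith [ht.2], by linarith [ht.1]⟩
  let w : ℝ → V → V := fun t x => -v (1 - t) x
  have hw : ∀ t ∈ Icc (0 : ℝ) 1, LipschitzWith (1 / 4) (w t) := fun t ht =>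
    (hv _ (hr t ht)).neg
  have hwc : ∀ x, ContinuousOn (fun t => w t x) (Icc 0 1) := fun x =>
    ((hc x).comp (by fun_prop) hr).neg
  have hw0 : ∀ t, w t 0 = 0 := fun t => by simp [w, h0]
  choose α hα0 hα using exists_isTrajectory hv hc h0
  choose β hβ0 hβ using exists_isTrajectory hw hwc hw0
  have one_mem : (1 : ℝ) ∈ Icc (0 : ℝ) 1 := by simp
  have cont : ∀ {u : ℝ → V → V} {γ : V → ℝ → V},
      (∀ t ∈ Icc (0 : ℝ) 1, LipschitzWith (1 / 4) (u t)) → (∀ x, γ x 0 = x) →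
      (∀ x, IsTrajectory u (γ x)) → Continuous fun x => γ x 1 := by
    intro u γ hu hγ0 hγ
    refine (LipschitzWith.of_dist_le_mul (K := 3 / 2) fun x y => ?_).continuous
    simpa [hγ0] using (hγ x).dist_le hu (hγ y) one_mem
  have uniq : ∀ {u : ℝ → V → V} {γ δ : ℝ → V},
      (∀ t ∈ Icc (0 : ℝ) 1, LipschitzWith (1 / 4) (u t)) → IsTrajectory u γ →
      IsTrajectory u δ → γ 0 = δ 0 → γ 1 = δ 1 := by
    intro u γ δ hu hγ hδ h
    have := hγ.dist_le hu hδ one_mem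
    rw [h, dist_self, mul_zero] at this
    exact dist_le_zero.1 this
  refine ⟨{ toFun := fun x => α x 1
            invFun := fun x => β x 1
            left_inv := fun x => ?_
            right_inv := fun x => ?_
            continuous_toFun := cont hv hα0 hα
            continuous_invFun := cont hw hβ0 hβ }, ?_, fun x => ⟨α x, hα0 x, rfl, hα x, ?_⟩⟩
  · have := uniq hw (hβ (α x 1)) (hα x).reverse (by simp [hβ0])
    simpa [hα0] using this
  · have hrev : IsTrajectory v fun t => β x (1 - t) := by
      have := (hβ x).reverse
      simpa [w] using this
    have := uniq hv (hα (β x 1)) hrev (by simp [hα0])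
    simpa [hβ0] using this
  · exact uniq hv (hα 0) (isTrajectory_zero h0) (hα0 0)
  · intro t ht
    simpa [hα0] using (hα x).dist_le hv (isTrajectory_zero h0) ht

end Flow

section Radial

variable {V : Type*} [NormedAddCommGroup V] [NormedSpace ℝ V]

/-- The radial retraction onto the closed ball of radius `r` around `0`. -/
def radialRetract (r : ℝ) (z : V) : V := (r / max r ‖z‖) • z

lemma radialRetract_of_norm_le {r : ℝ} (hr : 0 < r) {z : V} (hz : ‖z‖ ≤ r) :
    radialRetract r z = z := by
  rw [radialRetract, max_eq_left hz, div_self hr.ne', one_smul]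

lemma norm_radialRetract_le {r : ℝ} (hr : 0 < r) (z : V) : ‖radialRetract r z‖ ≤ r := by
  have hm : 0 < max r ‖z‖ := lt_max_of_lt_left hr
  rw [radialRetract, norm_smul, Real.norm_of_nonneg (by positivity), div_mul_eq_mul_div,
    div_le_iff₀ hm]
  exact mul_le_mul_of_nonneg_left (le_max_right _ _) hr.le

lemma lipschitzWith_radialRetract {r : ℝ} (hr : 0 < r) :
    LipschitzWith 2 (radialRetract r : V → V) := by
  refine LipschitzWith.of_dist_le_mul fun z w => ?_
  rw [dist_eq_norm, dist_eq_norm]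
  have hz : 0 < max r ‖z‖ := lt_max_of_lt_left hr
  have hw : 0 < max r ‖w‖ := lt_max_of_lt_left hr
  have key : radialRetract r z - radialRetract r w =
      (r / max r ‖z‖) • (z - w) + (r / max r ‖z‖ - r / max r ‖w‖) • w := by
    simp only [radialRetract, smul_sub, sub_smul]; abel
  have h1 : ‖(r / max r ‖z‖) • (z - w)‖ ≤ ‖z - w‖ := by
    rw [norm_smul, Real.norm_of_nonneg (by positivity)]
    exact mul_le_of_le_one_left (norm_nonneg _) ((div_le_one hz).2 (le_max_left _ _))
  have h2 : ‖(r / max r ‖z‖ - r / max r ‖w‖) • w‖ ≤ ‖z - w‖ := by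
    have e : (r / max r ‖z‖ - r / max r ‖w‖) =
        (r / max r ‖z‖) * (max r ‖w‖ - max r ‖z‖) / max r ‖w‖ := by
      field_simp
    have h3 : |max r ‖w‖ - max r ‖z‖| ≤ ‖z - w‖ :=
      calc |max r ‖w‖ - max r ‖z‖| ≤ |‖w‖ - ‖z‖| := by
            simpa using abs_max_sub_max_le_max r ‖w‖ r ‖z‖
        _ ≤ ‖w - z‖ := abs_norm_sub_norm_le w z
        _ = ‖z - w‖ := norm_sub_rev w z
    rw [norm_smul, e, norm_div, norm_mul, Real.norm_of_nonneg hw.le,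
      Real.norm_of_nonneg (by positivity : 0 ≤ r / max r ‖z‖), Real.norm_eq_abs,
      div_mul_eq_mul_div, div_le_iff₀ hw]
    have h4 : r / max r ‖z‖ ≤ 1 := (div_le_one hz).2 (le_max_left _ _)
    calc r / max r ‖z‖ * |max r ‖w‖ - max r ‖z‖| * ‖w‖
        ≤ 1 * ‖z - w‖ * max r ‖w‖ := by
          gcongr
          exact le_max_right _ _
      _ = ‖z - w‖ * max r ‖w‖ := by ring
  rw [key]
  refine (norm_add_le _ _).trans ?_
  push_cast
  linarith

end Radial

section Perturbation

variable {n : ℕ}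

/-- The inversion `ℓ ↦ ℓ* / ‖ℓ‖²` sending a nonzero functional to its minimal right inverse. -/
def dualInv (l : En n →L[ℂ] ℂ) : En n :=
  ((1 / ‖l‖) ^ 2 : ℝ) • (InnerProductSpace.toDual ℂ (En n)).symm l

lemma apply_dualInv {l : En n →L[ℂ] ℂ} (hl : l ≠ 0) : l (dualInv l) = 1 := by
  set y := (InnerProductSpace.toDual ℂ (En n)).symm l with hy
  have h1 : l y = inner ℂ y y := (InnerProductSpace.toDual_symm_apply).symm
  have h2 : ‖y‖ = ‖l‖ := by simp [hy]
  have h3 : (‖l‖ : ℂ) ≠ 0 := by simpa using hl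
  rw [dualInv, ← hy, ← Complex.coe_smul, map_smul, h1, inner_self_eq_norm_sq_to_K, h2]
  simp only [smul_eq_mul]
  push_cast
  simp
  field_simp

lemma norm_dualInv_sub {a b : En n →L[ℂ] ℂ} (ha : a ≠ 0) (hb : b ≠ 0) :
    ‖dualInv a - dualInv b‖ = ‖a - b‖ / (‖a‖ * ‖b‖) := by
  have ha' : (InnerProductSpace.toDual ℂ (En n)).symm a ≠ 0 := by simpa using ha
  have hb' : (InnerProductSpace.toDual ℂ (En n)).symm b ≠ 0 := by simpa using hb
  have h := dist_div_norm_sq_smul ha' hb' 1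
  simp only [LinearIsometryEquiv.norm_map, LinearIsometryEquiv.dist_map] at h
  rw [← dist_eq_norm, dualInv, dualInv, h, dist_eq_norm]
  ring

lemma norm_dualInv (a : En n →L[ℂ] ℂ) : ‖dualInv a‖ = ‖a‖⁻¹ := by
  rw [dualInv, norm_smul, LinearIsometryEquiv.norm_map, Real.norm_of_nonneg (by positivity)]
  rcases eq_or_ne ‖a‖ 0 with h | h
  · simp [h]
  · field_simp

/-- Equivalence of the germs at `0` of the zero sets, realised by a global homeomorphism. -/
def ZeroSetEquiv (f g : En n → ℂ) : Prop :=
  ∃ φ : En n ≃ₜ En n, φ 0 = 0 ∧ ∀ᶠ z in 𝓝 (0 : En n), (f z = 0 ↔ g (φ z) = 0)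

lemma ZeroSetEquiv.symm {f g : En n → ℂ} (h : ZeroSetEquiv f g) : ZeroSetEquiv g f := by
  obtain ⟨φ, h0, h⟩ := h
  have h0' : φ.symm 0 = 0 := by rw [← h0, φ.symm_apply_apply, h0]
  refine ⟨φ.symm, h0', ?_⟩
  have ht : Filter.Tendsto φ.symm (𝓝 0) (𝓝 0) := by
    simpa [h0'] using φ.symm.continuous.tendsto 0
  filter_upwards [ht.eventually h] with z hz
  simpa using hz.symm

lemma ZeroSetEquiv.trans {f g k : En n → ℂ} (h : ZeroSetEquiv f g) (h' : ZeroSetEquiv g k) :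
    ZeroSetEquiv f k := by
  obtain ⟨φ, h0, h⟩ := h
  obtain ⟨ψ, k0, k⟩ := h'
  refine ⟨φ.trans ψ, by simp [h0, k0], ?_⟩
  have ht : Filter.Tendsto φ (𝓝 0) (𝓝 0) := by
    simpa [h0] using φ.continuous.tendsto 0
  filter_upwards [ht.eventually k, h] with z hz hz'
  exact hz'.trans hz

lemma ZeroSetEquiv.topEquisingular {f g : En n → ℂ} (h : ZeroSetEquiv f g) :
    TopEquisingular f g := by
  obtain ⟨φ, h0, h⟩ := h
  refine ⟨{z | f z = 0 ↔ g (φ z) = 0}, φ '' {z | f z = 0 ↔ g (φ z) = 0}, h, ?_, φ, φ.symm, h0,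
    φ.continuous.continuousOn, φ.symm.continuous.continuousOn, mapsTo_image _ _, ?_,
    fun z _ => φ.symm_apply_apply z, fun z _ => φ.apply_symm_apply z, ?_⟩
  · have := φ.isOpenMap.image_mem_nhds h
    rwa [h0] at this
  · rintro _ ⟨z, hz, rfl⟩
    rwa [φ.symm_apply_apply]
  · ext y
    constructor
    · rintro ⟨z, ⟨hz, hz'⟩, rfl⟩
      exact ⟨hz'.1 hz, mem_image_of_mem _ hz'⟩
    · rintro ⟨hy, z, hz, rfl⟩
      exact ⟨z, ⟨hz.2 hy, hz⟩, rfl⟩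

/-- Quantitative vanishing of `h` to order `m + 1` at `0`, together with its first two
derivatives. -/
structure HasOrder (ρ C : ℝ) (m : ℕ) (h : En n → ℂ) : Prop where
  differentiableAt : ∀ z ∈ ball (0 : En n) ρ, DifferentiableAt ℂ h z
  apply_zero : h 0 = 0
  norm_sub_le : ∀ z ∈ ball (0 : En n) ρ, ∀ w, ‖w‖ ≤ ‖z‖ → ‖h z - h w‖ ≤ C * ‖z‖ ^ m * ‖z - w‖
  norm_fderiv_le : ∀ z ∈ ball (0 : En n) ρ, z ≠ 0 → ‖fderiv ℂ h z‖ ≤ C * ‖z‖ ^ m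
  norm_fderiv_sub_le : ∀ z ∈ ball (0 : En n) ρ, ∀ w, w ≠ 0 → ‖w‖ ≤ ‖z‖ →
    ‖w‖ * ‖fderiv ℂ h z - fderiv ℂ h w‖ ≤ C * ‖z‖ ^ m * ‖z - w‖

/-- The vector field whose trajectories preserve the values of `F + t h`. -/
def kuoField (F h : En n → ℂ) (t : ℝ) (z : En n) : En n :=
  -(h z • dualInv (fderiv ℂ F z + (t : ℂ) • fderiv ℂ h z))

variable {ρ c M ε : ℝ} {m : ℕ} {F h : En n → ℂ}

lemma HasOrder.le_norm_fderiv_add (hh : HasOrder ρ ε m h) (hcε : ε ≤ c / 2)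
    (hc : ∀ z ∈ ball (0 : En n) ρ, z ≠ 0 → c * ‖z‖ ^ m ≤ ‖fderiv ℂ F z‖)
    {t : ℝ} (ht : t ∈ Icc (0 : ℝ) 1) {z : En n} (hz : z ∈ ball (0 : En n) ρ) (hz0 : z ≠ 0) :
    c / 2 * ‖z‖ ^ m ≤ ‖fderiv ℂ F z + (t : ℂ) • fderiv ℂ h z‖ := by
  have h1 := hc z hz hz0
  have h2 := hh.norm_fderiv_le z hz hz0
  have h3 : ‖(t : ℂ) • fderiv ℂ h z‖ ≤ ‖fderiv ℂ h z‖ := by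
    rw [norm_smul, Complex.norm_real, Real.norm_of_nonneg ht.1]
    exact mul_le_of_le_one_left (norm_nonneg _) ht.2
  have h4 : ε * ‖z‖ ^ m ≤ c / 2 * ‖z‖ ^ m := by gcongr
  have h5 := norm_sub_le_norm_add (fderiv ℂ F z) ((t : ℂ) • fderiv ℂ h z)
  linarith

lemma norm_kuoField_sub_le (hF : HasOrder ρ M m F) (hh : HasOrder ρ ε m h) (hc0 : 0 < c)
    (hε : 0 ≤ ε) (hM : 0 ≤ M) (hcε : ε ≤ c / 2) (hcM : 8 * ε * (2 * c + 4 * (M + ε)) ≤ c ^ 2)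
    (hc : ∀ z ∈ ball (0 : En n) ρ, z ≠ 0 → c * ‖z‖ ^ m ≤ ‖fderiv ℂ F z‖)
    {t : ℝ} (ht : t ∈ Icc (0 : ℝ) 1) {z w : En n} (hz : z ∈ ball (0 : En n) ρ)
    (hwz : ‖w‖ ≤ ‖z‖) :
    ‖kuoField F h t z - kuoField F h t w‖ ≤ 1 / 8 * ‖z - w‖ := by
  rcases eq_or_ne z 0 with rfl | hz0
  · have : w = 0 := by simpa using hwz
    simp [this]
  have hzp : 0 < ‖z‖ := norm_pos_iff.2 hz0
  set a := fderiv ℂ F z + (t : ℂ) • fderiv ℂ h z with ha_def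
  have ha : c / 2 * ‖z‖ ^ m ≤ ‖a‖ := hh.le_norm_fderiv_add hcε hc ht hz hz0
  have hap : 0 < ‖a‖ := lt_of_lt_of_le (by positivity) ha
  have first : ‖h z - h w‖ * ‖dualInv a‖ ≤ 2 * ε / c * ‖z - w‖ := by
    rw [norm_dualInv, ← div_eq_mul_inv, div_le_iff₀ hap]
    calc ‖h z - h w‖ ≤ ε * ‖z‖ ^ m * ‖z - w‖ := hh.norm_sub_le z hz w hwz
      _ = 2 * ε / c * ‖z - w‖ * (c / 2 * ‖z‖ ^ m) := by field_simp
      _ ≤ _ := by gcongr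
  have tot : 2 * ε / c + 4 * ε * (M + ε) / c ^ 2 ≤ 1 / 8 := by
    have : 2 * ε / c + 4 * ε * (M + ε) / c ^ 2 = (ε * (2 * c + 4 * (M + ε))) / c ^ 2 := by
      field_simp
    rw [this, div_le_iff₀ (by positivity)]
    linarith
  have h8 : 2 * ε / c ≤ 1 / 8 := by
    refine le_trans ?_ tot
    have : 0 ≤ 4 * ε * (M + ε) / c ^ 2 := by positivity
    linarith
  rcases eq_or_ne w 0 with rfl | hw0
  · have : ‖kuoField F h t z - kuoField F h t 0‖ = ‖h z - h 0‖ * ‖dualInv a‖ := by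
      simp [kuoField, hh.apply_zero, norm_smul, ha_def]
    rw [this]
    exact first.trans (by gcongr)
  have hwp : 0 < ‖w‖ := norm_pos_iff.2 hw0
  have hw : w ∈ ball (0 : En n) ρ := by
    rw [mem_ball_zero_iff] at hz ⊢
    exact hwz.trans_lt hz
  set b := fderiv ℂ F w + (t : ℂ) • fderiv ℂ h w with hb_def
  have hb : c / 2 * ‖w‖ ^ m ≤ ‖b‖ := hh.le_norm_fderiv_add hcε hc ht hw hw0
  have hbp : 0 < ‖b‖ := lt_of_lt_of_le (by positivity) hb
  have hab : ‖w‖ * ‖a - b‖ ≤ (M + ε) * ‖z‖ ^ m * ‖z - w‖ := by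
    have h1 := hF.norm_fderiv_sub_le z hz w hw0 hwz
    have h2 := hh.norm_fderiv_sub_le z hz w hw0 hwz
    have h3 : ‖a - b‖ ≤ ‖fderiv ℂ F z - fderiv ℂ F w‖ + ‖fderiv ℂ h z - fderiv ℂ h w‖ := by
      have : a - b = (fderiv ℂ F z - fderiv ℂ F w) +
          (t : ℂ) • (fderiv ℂ h z - fderiv ℂ h w) := by
        rw [ha_def, hb_def, smul_sub]; abel
      rw [this]
      refine (norm_add_le _ _).trans ?_
      gcongr
      rw [norm_smul, Complex.norm_real, Real.norm_of_nonneg ht.1]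
      exact mul_le_of_le_one_left (norm_nonneg _) ht.2
    calc ‖w‖ * ‖a - b‖ ≤ ‖w‖ * (‖fderiv ℂ F z - fderiv ℂ F w‖ +
          ‖fderiv ℂ h z - fderiv ℂ h w‖) := by gcongr
      _ ≤ (M + ε) * ‖z‖ ^ m * ‖z - w‖ := by linarith
  have second : ‖h w‖ * ‖dualInv a - dualInv b‖ ≤ 4 * ε * (M + ε) / c ^ 2 * ‖z - w‖ := by
    rw [norm_dualInv_sub (norm_pos_iff.1 hap) (norm_pos_iff.1 hbp), mul_div_assoc',
      div_le_iff₀ (by positivity)]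
    have h1 : ‖h w‖ ≤ ε * ‖w‖ ^ m * ‖w‖ := by
      simpa [hh.apply_zero] using hh.norm_sub_le w hw 0 (by simp)
    calc ‖h w‖ * ‖a - b‖ ≤ ε * ‖w‖ ^ m * ‖w‖ * ‖a - b‖ := by gcongr
      _ = ε * ‖w‖ ^ m * (‖w‖ * ‖a - b‖) := by ring
      _ ≤ ε * ‖w‖ ^ m * ((M + ε) * ‖z‖ ^ m * ‖z - w‖) := by gcongr
      _ = 4 * ε * (M + ε) / c ^ 2 * ‖z - w‖ * ((c / 2 * ‖z‖ ^ m) * (c / 2 * ‖w‖ ^ m)) := by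
        field_simp; ring
      _ ≤ _ := by gcongr
  have split : kuoField F h t z - kuoField F h t w =
      -((h z - h w) • dualInv a + h w • (dualInv a - dualInv b)) := by
    simp only [kuoField, ← ha_def, ← hb_def, sub_smul, smul_sub]; abel
  rw [split, norm_neg]
  calc _ ≤ ‖h z - h w‖ * ‖dualInv a‖ + ‖h w‖ * ‖dualInv a - dualInv b‖ := by
        refine (norm_add_le _ _).trans ?_
        rw [norm_smul, norm_smul]
    _ ≤ (2 * ε / c + 4 * ε * (M + ε) / c ^ 2) * ‖z - w‖ := by linarith
    _ ≤ _ := by gcongr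

lemma continuous_kuoField_time (hh : HasOrder ρ ε m h) (hc0 : 0 < c)
    (hcε : ε ≤ c / 2)
    (hc : ∀ z ∈ ball (0 : En n) ρ, z ≠ 0 → c * ‖z‖ ^ m ≤ ‖fderiv ℂ F z‖)
    {z : En n} (hz : z ∈ ball (0 : En n) ρ) :
    ContinuousOn (fun t => kuoField F h t z) (Icc 0 1) := by
  rcases eq_or_ne z 0 with rfl | hz0
  · simp only [kuoField, hh.apply_zero, zero_smul]
    exact continuousOn_const
  have hzp : 0 < ‖z‖ := norm_pos_iff.2 hz0
  have hne : ∀ t ∈ Icc (0 : ℝ) 1, ‖fderiv ℂ F z + (t : ℂ) • fderiv ℂ h z‖ ≠ 0 := fun t ht =>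
    (lt_of_lt_of_le (by positivity) (hh.le_norm_fderiv_add hcε hc ht hz hz0)).ne'
  have hG : Continuous fun t : ℝ => fderiv ℂ F z + (t : ℂ) • fderiv ℂ h z := by fun_prop
  have key : ContinuousOn
      (fun t : ℝ => dualInv (fderiv ℂ F z + (t : ℂ) • fderiv ℂ h z)) (Icc 0 1) :=
    ((ContinuousOn.div continuousOn_const hG.norm.continuousOn hne).pow 2).smul
      ((InnerProductSpace.toDual ℂ (En n)).symm.continuous.comp hG).continuousOn
  exact (key.const_smul (h z)).neg

/-- A small perturbation (relative to the size of the gradient) does not change the topological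
type of the zero set. -/
lemma zeroSetEquiv_add (hρ : 0 < ρ) (hF : HasOrder ρ M m F) (hh : HasOrder ρ ε m h) (hc0 : 0 < c)
    (hε : 0 ≤ ε) (hM : 0 ≤ M) (hcε : ε ≤ c / 2) (hcM : 8 * ε * (2 * c + 4 * (M + ε)) ≤ c ^ 2)
    (hc : ∀ z ∈ ball (0 : En n) ρ, z ≠ 0 → c * ‖z‖ ^ m ≤ ‖fderiv ℂ F z‖) :
    ZeroSetEquiv F (fun z => F z + h z) := by
  have hρ2 : 0 < ρ / 2 := half_pos hρ
  have hball : ∀ z : En n, radialRetract (ρ / 2) z ∈ ball (0 : En n) ρ := fun z => by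
    rw [mem_ball_zero_iff]
    exact (norm_radialRetract_le hρ2 z).trans_lt (half_lt_self hρ)
  let v : ℝ → En n → En n := fun t z => kuoField F h t (radialRetract (ρ / 2) z)
  have hv : ∀ t ∈ Icc (0 : ℝ) 1, LipschitzWith (1 / 4) (v t) := by
    intro t ht
    refine LipschitzWith.of_dist_le_mul fun z w => ?_
    have h1 : dist (v t z) (v t w) ≤
        1 / 8 * dist (radialRetract (ρ / 2) z) (radialRetract (ρ / 2) w) := by
      rcases le_total ‖radialRetract (ρ / 2) w‖ ‖radialRetract (ρ / 2) z‖ with hle | hle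
      · rw [dist_eq_norm, dist_eq_norm]
        exact norm_kuoField_sub_le hF hh hc0 hε hM hcε hcM hc ht (hball z) hle
      · rw [dist_comm, dist_comm (radialRetract (ρ / 2) z), dist_eq_norm, dist_eq_norm]
        exact norm_kuoField_sub_le hF hh hc0 hε hM hcε hcM hc ht (hball w) hle
    have h2 := (lipschitzWith_radialRetract hρ2).dist_le_mul z w
    push_cast at h2 ⊢
    linarith
  have hvc : ∀ z, ContinuousOn (fun t => v t z) (Icc 0 1) := fun z =>
    continuous_kuoField_time hh hc0 hcε hc (hball z)
  have hv0 : ∀ t, v t 0 = 0 := fun t => by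
    simp [v, radialRetract, kuoField, hh.apply_zero]
  obtain ⟨φ, hφ0, hφ⟩ := exists_homeomorph_flow hv hvc hv0
  refine ⟨φ, hφ0, ?_⟩
  filter_upwards [ball_mem_nhds (0 : En n) (show 0 < ρ / 4 by positivity)] with x hx
  rw [mem_ball_zero_iff] at hx
  obtain ⟨α, hα0, hα1, hα, hαx⟩ := hφ x
  have hαball : ∀ t ∈ Icc (0 : ℝ) 1, ‖α t‖ ≤ ρ / 2 := fun t ht =>
    (hαx t ht).trans (by linarith)
  have hder : ∀ t ∈ Icc (0 : ℝ) 1,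
      HasDerivWithinAt (fun s => F (α s) + (s : ℂ) * h (α s)) 0 (Icc 0 1) t := by
    intro t ht
    have hαt : α t ∈ ball (0 : En n) ρ := by
      rw [mem_ball_zero_iff]
      exact (hαball t ht).trans_lt (half_lt_self hρ)
    have h1 := hα t ht
    have hvt : v t (α t) = kuoField F h t (α t) := by
      simp only [v, radialRetract_of_norm_le hρ2 (hαball t ht)]
    rw [hvt] at h1
    have hF1 := ((hF.differentiableAt _ hαt).hasFDerivAt.restrictScalars ℝ).comp_hasDerivWithinAt t h1
    have hh1 := ((hh.differentiableAt _ hαt).hasFDerivAt.restrictScalars ℝ).comp_hasDerivWithinAt t h1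
    have ht1 : HasDerivWithinAt (fun s : ℝ => (s : ℂ)) 1 (Icc 0 1) t :=
      (Complex.ofRealCLM.hasDerivAt (x := t)).hasDerivWithinAt
    refine (hF1.add (ht1.mul hh1)).congr_deriv ?_
    simp only [ContinuousLinearMap.coe_restrictScalars', Function.comp, one_mul]
    rcases eq_or_ne (α t) 0 with hz | hz
    · simp [hz, kuoField, hh.apply_zero]
    · have hne : fderiv ℂ F (α t) + (t : ℂ) • fderiv ℂ h (α t) ≠ 0 := by
        have hzp : 0 < ‖α t‖ := norm_pos_iff.2 hz
        exact norm_pos_iff.1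
          (lt_of_lt_of_le (by positivity) (hh.le_norm_fderiv_add hcε hc ht hαt hz))
      have h2 := apply_dualInv hne
      have h3 : (fderiv ℂ F (α t) + (t : ℂ) • fderiv ℂ h (α t)) (kuoField F h t (α t)) =
          -h (α t) := by
        rw [kuoField, map_neg, map_smul, h2, smul_eq_mul, mul_one]
      simp only [add_apply, smul_apply, smul_eq_mul] at h3
      linear_combination h3
  have hconst := constant_of_has_deriv_right_zero
    (fun t ht => (hder t ht).continuousWithinAt)
    (fun t ht => (hder t ⟨ht.1, ht.2.le⟩).mono_of_mem_nhdsWithin (Icc_mem_nhdsGE_of_mem ht))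
    1 (by simp)
  simp only [hα0, hα1, Complex.ofReal_one, one_mul, Complex.ofReal_zero, zero_mul,
    add_zero] at hconst
  rw [hconst]

end Perturbation

section Cauchy

variable {n : ℕ}

/-- Cauchy's estimate for the derivative at the centre of a ball. -/
lemma norm_fderiv_le_of_ball {W : Type*} [NormedAddCommGroup W] [NormedSpace ℂ W]
    {g : En n → W} {x : En n} {r B : ℝ} (hr : 0 < r) (hd : DifferentiableOn ℂ g (ball x r))
    (hB : ∀ y ∈ ball x r, ‖g y‖ ≤ B) : ‖fderiv ℂ g x‖ ≤ 2 * B / r := by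
  refine Complex.norm_fderiv_le_div_of_mapsTo_ball hd (fun y hy => ?_) hr
  rw [mem_closedBall, dist_eq_norm]
  refine (norm_sub_le _ _).trans ?_
  linarith [hB y hy, hB x (mem_ball_self hr)]

/-- The constant relating the size of a holomorphic function to that of its derivatives. -/
def orderConst (m : ℕ) : ℝ := 256 * 8 ^ m

lemma hasOrder_of_norm_le {ρ A : ℝ} {m : ℕ} {h : En n → ℂ} (hρ : 0 < ρ)
    (hA : 0 ≤ A) (ha : AnalyticOnNhd ℂ h (ball 0 (8 * ρ)))
    (hb : ∀ z ∈ ball (0 : En n) (8 * ρ), ‖h z‖ ≤ A * ‖z‖ ^ (m + 1)) :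
    HasOrder ρ (orderConst m * A) m h := by
  have hd : DifferentiableOn ℂ h (ball 0 (8 * ρ)) := ha.differentiableOn
  have hdat : ∀ z ∈ ball (0 : En n) (8 * ρ), DifferentiableAt ℂ h z := fun z hz =>
    hd.differentiableAt (isOpen_ball.mem_nhds hz)
  have h1 : ∀ x : En n, x ≠ 0 → ‖x‖ < 4 * ρ → ‖fderiv ℂ h x‖ ≤ 4 * 2 ^ m * A * ‖x‖ ^ m := by
    intro x hx0 hx
    have hxp : 0 < ‖x‖ := norm_pos_iff.2 hx0
    have hn : ∀ y ∈ ball x ‖x‖, ‖y‖ ≤ 2 * ‖x‖ := fun y hy => by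
      rw [mem_ball, dist_eq_norm] at hy
      linarith [norm_le_norm_add_norm_sub' y x]
    have hsub : ∀ y ∈ ball x ‖x‖, y ∈ ball (0 : En n) (8 * ρ) := fun y hy => by
      rw [mem_ball_zero_iff]
      linarith [hn y hy]
    have := norm_fderiv_le_of_ball hxp (hd.mono hsub) (B := A * (2 * ‖x‖) ^ (m + 1))
      (fun y hy => (hb y (hsub y hy)).trans (by gcongr; exact hn y hy))
    refine this.trans (le_of_eq ?_)
    field_simp
    ring
  have hd1 : DifferentiableOn ℂ (fderiv ℂ h) (ball 0 (8 * ρ)) :=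
    ha.fderiv.differentiableOn
  have h2 : ∀ x : En n, x ≠ 0 → ‖x‖ < 2 * ρ →
      ‖x‖ * ‖fderiv ℂ (fderiv ℂ h) x‖ ≤ 16 * 4 ^ m * A * ‖x‖ ^ m := by
    intro x hx0 hx
    have hxp : 0 < ‖x‖ := norm_pos_iff.2 hx0
    have hn : ∀ y ∈ ball x (‖x‖ / 2), ‖y‖ ≤ 2 * ‖x‖ ∧ y ≠ 0 := fun y hy => by
      rw [mem_ball, dist_eq_norm] at hy
      refine ⟨by linarith [norm_le_norm_add_norm_sub' y x], ?_⟩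
      rintro rfl
      rw [zero_sub, norm_neg] at hy
      linarith
    have hsub : ∀ y ∈ ball x (‖x‖ / 2), y ∈ ball (0 : En n) (8 * ρ) := fun y hy => by
      rw [mem_ball_zero_iff]
      linarith [(hn y hy).1]
    have := norm_fderiv_le_of_ball (half_pos hxp) (hd1.mono hsub)
      (B := 4 * 2 ^ m * A * (2 * ‖x‖) ^ m)
      (fun y hy => (h1 y (hn y hy).2 (by linarith [(hn y hy).1])).trans
        (by gcongr; exact (hn y hy).1))
    calc ‖x‖ * ‖fderiv ℂ (fderiv ℂ h) x‖
        ≤ ‖x‖ * (2 * (4 * 2 ^ m * A * (2 * ‖x‖) ^ m) / (‖x‖ / 2)) := by gcongr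
      _ = 16 * 4 ^ m * A * ‖x‖ ^ m := by
        have : (4 : ℝ) ^ m = 2 ^ m * 2 ^ m := by rw [← mul_pow]; norm_num
        rw [this]
        field_simp
        ring
  have h8 : (1 : ℝ) ≤ 8 ^ m := one_le_pow₀ (by norm_num)
  have h28 : (2 : ℝ) ^ m ≤ 8 ^ m := by gcongr; norm_num
  -- on the ball `closedBall w (‖w‖ / 2)` all points have comparable norm
  have near : ∀ z ∈ ball (0 : En n) ρ, ∀ w : En n, w ≠ 0 → ‖w‖ ≤ ‖z‖ →
      ∀ x ∈ closedBall w (‖w‖ / 2), x ≠ 0 ∧ ‖x‖ ≤ 2 * ‖z‖ ∧ ‖w‖ ≤ 2 * ‖x‖ ∧ ‖x‖ < 2 * ρ := by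
    intro z hz w hw0 hwz x hx
    have hwp : 0 < ‖w‖ := norm_pos_iff.2 hw0
    rw [mem_ball_zero_iff] at hz
    rw [mem_closedBall, dist_eq_norm] at hx
    have e1 := norm_le_norm_add_norm_sub' x w
    have e2 := norm_le_norm_add_norm_sub x w
    refine ⟨?_, by linarith, by linarith, by linarith⟩
    rintro rfl
    rw [norm_zero] at e2
    linarith [norm_nonneg ((0 : En n) - w)]
  refine ⟨fun z hz => hdat z ?_, ?_, ?_, ?_, ?_⟩
  · rw [mem_ball_zero_iff] at hz ⊢
    linarith [norm_nonneg z]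
  · simpa using hb 0 (mem_ball_self (by positivity))
  · intro z hz w hwz
    have hz' : z ∈ ball (0 : En n) (8 * ρ) := by
      rw [mem_ball_zero_iff] at hz ⊢
      linarith [norm_nonneg z]
    have hw' : w ∈ ball (0 : En n) (8 * ρ) := by
      rw [mem_ball_zero_iff] at hz' ⊢
      linarith
    by_cases hc : w ≠ 0 ∧ ‖z - w‖ ≤ ‖w‖ / 2
    · have hnear := near z hz w hc.1 hwz
      have := (convex_closedBall w (‖w‖ / 2)).norm_image_sub_le_of_norm_fderiv_le (𝕜 := ℂ)
        (f := h) (C := 4 * 2 ^ m * A * (2 * ‖z‖) ^ m)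
        (fun x hx => hdat x (by
          rw [mem_ball_zero_iff]; linarith [(hnear x hx).2.2.2, norm_nonneg x]))
        (fun x hx => (h1 x (hnear x hx).1 (by
          linarith [(hnear x hx).2.2.2, norm_nonneg x])).trans (by
            gcongr; exact (hnear x hx).2.1))
        (mem_closedBall_self (by positivity))
        (show z ∈ closedBall w (‖w‖ / 2) by rw [mem_closedBall, dist_eq_norm]; exact hc.2)
      refine this.trans ?_
      rw [orderConst, mul_pow]
      have : (2 : ℝ) ^ m * 2 ^ m ≤ 8 ^ m := by
        rw [← mul_pow]; gcongr; norm_num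
      calc 4 * 2 ^ m * A * (2 ^ m * ‖z‖ ^ m) * ‖z - w‖
          = 4 * A * (2 ^ m * 2 ^ m) * ‖z‖ ^ m * ‖z - w‖ := by ring
        _ ≤ 256 * A * 8 ^ m * ‖z‖ ^ m * ‖z - w‖ := by gcongr; norm_num
        _ = _ := by ring
    · have hzw : ‖z‖ ≤ 3 * ‖z - w‖ := by
        have e1 := norm_le_norm_add_norm_sub' z w
        rw [not_and_or, not_not, not_le] at hc
        rcases hc with rfl | hc
        · simp; linarith [norm_nonneg z]
        · linarith
      have e1 := hb z hz'
      have e2 : ‖h w‖ ≤ A * ‖z‖ ^ (m + 1) := (hb w hw').trans (by gcongr)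
      calc ‖h z - h w‖ ≤ ‖h z‖ + ‖h w‖ := norm_sub_le _ _
        _ ≤ 2 * A * ‖z‖ ^ m * ‖z‖ := by rw [pow_succ] at e1 e2; linarith
        _ ≤ 2 * A * ‖z‖ ^ m * (3 * ‖z - w‖) := by gcongr
        _ = (6 * 1) * A * ‖z‖ ^ m * ‖z - w‖ := by ring
        _ ≤ (256 * 8 ^ m) * A * ‖z‖ ^ m * ‖z - w‖ := by gcongr; norm_num
  · intro z hz hz0
    rw [mem_ball_zero_iff] at hz
    refine (h1 z hz0 (by linarith [norm_nonneg z])).trans ?_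
    rw [orderConst]
    gcongr
    norm_num
  · intro z hz w hw0 hwz
    have hwp : 0 < ‖w‖ := norm_pos_iff.2 hw0
    have hzp : 0 < ‖z‖ := hwp.trans_le hwz
    have hz' : ‖z‖ < ρ := by rwa [mem_ball_zero_iff] at hz
    by_cases hc : ‖z - w‖ ≤ ‖w‖ / 2
    · have hnear := near z hz w hw0 hwz
      have := (convex_closedBall w (‖w‖ / 2)).norm_image_sub_le_of_norm_fderiv_le (𝕜 := ℂ)
        (f := fderiv ℂ h) (C := 2 / ‖w‖ * (16 * 4 ^ m * A * (2 * ‖z‖) ^ m))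
        (fun x hx => hd1.differentiableAt (isOpen_ball.mem_nhds (by
          rw [mem_ball_zero_iff]; linarith [(hnear x hx).2.2.2, norm_nonneg x])))
        (fun x hx => ?_)
        (mem_closedBall_self (by positivity))
        (show z ∈ closedBall w (‖w‖ / 2) by rw [mem_closedBall, dist_eq_norm]; exact hc)
      · have h48 : (4 : ℝ) ^ m * 2 ^ m = 8 ^ m := by rw [← mul_pow]; norm_num
        calc ‖w‖ * ‖fderiv ℂ h z - fderiv ℂ h w‖
            ≤ ‖w‖ * (2 / ‖w‖ * (16 * 4 ^ m * A * (2 * ‖z‖) ^ m) * ‖z - w‖) := by gcongr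
          _ = 32 * (4 ^ m * 2 ^ m) * A * ‖z‖ ^ m * ‖z - w‖ := by
            rw [mul_pow]; field_simp; ring
          _ ≤ orderConst m * A * ‖z‖ ^ m * ‖z - w‖ := by
            rw [h48, orderConst]; gcongr; norm_num
      · obtain ⟨k0, k1, k2, k3⟩ := hnear x hx
        have e := h2 x k0 k3
        have e' : ‖w‖ * ‖fderiv ℂ (fderiv ℂ h) x‖ ≤ 2 * (16 * 4 ^ m * A * (2 * ‖z‖) ^ m) :=
          calc ‖w‖ * ‖fderiv ℂ (fderiv ℂ h) x‖
              ≤ 2 * ‖x‖ * ‖fderiv ℂ (fderiv ℂ h) x‖ := by gcongr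
            _ ≤ 2 * (16 * 4 ^ m * A * ‖x‖ ^ m) := by linarith
            _ ≤ _ := by gcongr
        rw [div_mul_eq_mul_div, le_div_iff₀ hwp]
        linarith
    · push Not at hc
      have e1 := h1 z (norm_pos_iff.1 hzp) (by linarith)
      have e2 : ‖fderiv ℂ h w‖ ≤ 4 * 2 ^ m * A * ‖z‖ ^ m :=
        (h1 w hw0 (by linarith)).trans (by gcongr)
      calc ‖w‖ * ‖fderiv ℂ h z - fderiv ℂ h w‖
          ≤ (2 * ‖z - w‖) * (‖fderiv ℂ h z‖ + ‖fderiv ℂ h w‖) := by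
            gcongr
            · linarith
            · exact norm_sub_le _ _
        _ ≤ (2 * ‖z - w‖) * (8 * 2 ^ m * A * ‖z‖ ^ m) := by gcongr; linarith
        _ = 16 * 2 ^ m * A * ‖z‖ ^ m * ‖z - w‖ := by ring
        _ ≤ orderConst m * A * ‖z‖ ^ m * ‖z - w‖ := by
          rw [orderConst]; gcongr; norm_num

end Cauchy

section Homogeneous

variable {n m : ℕ}

/-- An entire function on `ℂⁿ` which is homogeneous of degree `d`. -/
structure IsHomogFun (d : ℕ) (Q : En n → ℂ) : Prop where
  analytic : AnalyticOnNhd ℂ Q univ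
  map_smul : ∀ (r : ℂ) (z : En n), Q (r • z) = r ^ d * Q z

lemma exists_norm_le_of_homogeneous {W : Type*} [NormedAddCommGroup W] {d : ℕ}
    {G : En n → W} (hG : Continuous G)
    (hs : ∀ (r : ℂ) (z : En n), r ≠ 0 → ‖G (r • z)‖ = ‖r‖ ^ d * ‖G z‖) :
    ∃ A : ℝ, 0 ≤ A ∧ ∀ z : En n, z ≠ 0 → ‖G z‖ ≤ A * ‖z‖ ^ d := by
  obtain ⟨A, hA⟩ := (isCompact_sphere (0 : En n) 1).exists_bound_of_continuousOn hG.continuousOn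
  refine ⟨max A 0, le_max_right _ _, fun z hz => ?_⟩
  have hzn : 0 < ‖z‖ := norm_pos_iff.2 hz
  have hr : ((‖z‖ : ℝ) : ℂ) ≠ 0 := by exact_mod_cast hzn.ne'
  have hz1 : z = ((‖z‖ : ℝ) : ℂ) • (((‖z‖ : ℝ) : ℂ)⁻¹ • z) := by
    rw [smul_smul, mul_inv_cancel₀ hr, one_smul]
  have hu : ((‖z‖ : ℝ) : ℂ)⁻¹ • z ∈ sphere (0 : En n) 1 := by
    rw [mem_sphere_zero_iff_norm, norm_smul, norm_inv, Complex.norm_real, norm_norm,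
      inv_mul_cancel₀ hzn.ne']
  have h1 := hs _ (((‖z‖ : ℝ) : ℂ)⁻¹ • z) hr
  rw [← hz1, Complex.norm_real, norm_norm] at h1
  rw [h1, mul_comm]
  gcongr
  exact (hA _ hu).trans (le_max_left _ _)

lemma IsHomogFun.exists_norm_le {d : ℕ} {Q : En n → ℂ} (hQ : IsHomogFun (d + 1) Q) :
    ∃ A : ℝ, 0 ≤ A ∧ ∀ z : En n, ‖Q z‖ ≤ A * ‖z‖ ^ (d + 1) := by
  obtain ⟨A, hA, h⟩ := exists_norm_le_of_homogeneous (d := d + 1)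
    (continuousOn_univ.1 hQ.analytic.continuousOn)
    (fun r z _ => by rw [hQ.map_smul, norm_mul, norm_pow])
  refine ⟨A, hA, fun z => ?_⟩
  rcases eq_or_ne z 0 with rfl | hz
  · have := hQ.map_smul 0 0
    simp only [smul_zero, zero_pow (Nat.succ_ne_zero d), zero_mul] at this
    simp [this]
  · exact h z hz

lemma IsHomogFun.fderiv_smul {d : ℕ} {Q : En n → ℂ} (hQ : IsHomogFun (d + 1) Q) {r : ℂ}
    (hr : r ≠ 0) (z : En n) : fderiv ℂ Q (r • z) = r ^ d • fderiv ℂ Q z := by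
  have hd : Differentiable ℂ Q := fun z => (hQ.analytic z (mem_univ _)).differentiableAt
  have h1 : fderiv ℂ (fun w : En n => Q (r • w)) z = r • fderiv ℂ Q (r • z) := fderiv_comp_smul r
  have h2 : fderiv ℂ (fun w : En n => Q (r • w)) z = r ^ (d + 1) • fderiv ℂ Q z := by
    simp only [hQ.map_smul]
    exact fderiv_const_mul (hd z) _
  rw [h1, pow_succ', mul_smul] at h2
  exact smul_right_injective _ hr h2

lemma IsHomogFun.exists_le_norm_fderiv {d : ℕ} {Q : En n → ℂ} (hQ : IsHomogFun (d + 1) Q)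
    (h0 : ∀ z : En n, z ≠ 0 → fderiv ℂ Q z ≠ 0) :
    ∃ c : ℝ, 0 < c ∧ ∀ z : En n, z ≠ 0 → c * ‖z‖ ^ d ≤ ‖fderiv ℂ Q z‖ := by
  have hc : Continuous (fderiv ℂ Q) := continuousOn_univ.1 hQ.analytic.fderiv.continuousOn
  obtain ⟨A, hA⟩ := (isCompact_sphere (0 : En n) 1).exists_bound_of_continuousOn
    (f := fun z => ‖fderiv ℂ Q z‖⁻¹) (hc.norm.continuousOn.inv₀ (fun z hz => by
      refine norm_ne_zero_iff.2 (h0 z ?_)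
      rintro rfl
      simp at hz))
  refine ⟨(max A 1)⁻¹, by positivity, fun z hz => ?_⟩
  have hzn : 0 < ‖z‖ := norm_pos_iff.2 hz
  have hr : ((‖z‖ : ℝ) : ℂ) ≠ 0 := by exact_mod_cast hzn.ne'
  set u : En n := ((‖z‖ : ℝ) : ℂ)⁻¹ • z with hu_def
  have hz1 : z = ((‖z‖ : ℝ) : ℂ) • u := by
    rw [hu_def, smul_smul, mul_inv_cancel₀ hr, one_smul]
  have hu : u ∈ sphere (0 : En n) 1 := by
    rw [mem_sphere_zero_iff_norm, norm_smul, norm_inv, Complex.norm_real, norm_norm,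
      inv_mul_cancel₀ hzn.ne']
  have hu0 : u ≠ 0 := by
    rintro h
    simp [h] at hu
  have h1 : ‖fderiv ℂ Q z‖ = ‖z‖ ^ d * ‖fderiv ℂ Q u‖ := by
    conv_lhs => rw [hz1, hQ.fderiv_smul hr, norm_smul, norm_pow, Complex.norm_real, norm_norm]
  rw [h1, mul_comm]
  gcongr
  have hp : 0 < ‖fderiv ℂ Q u‖ := norm_pos_iff.2 (h0 u hu0)
  refine inv_le_of_inv_le₀ hp ?_
  have := hA u hu
  rw [norm_inv, norm_norm] at this
  exact this.trans (le_max_left _ _)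

lemma IsHomogFun.add_mul {d : ℕ} {P R : En n → ℂ} (hP : IsHomogFun d P) (hR : IsHomogFun d R)
    (t : ℂ) : IsHomogFun d (fun z => P z + t * R z) where
  analytic := hP.analytic.add (analyticOnNhd_const.mul hR.analytic)
  map_smul r z := by rw [hP.map_smul, hR.map_smul]; ring

lemma IsHomogFun.hasOrder {Q : En n → ℂ} (hQ : IsHomogFun (m + 1) Q) :
    ∃ A : ℝ, 0 ≤ A ∧ ∀ ρ : ℝ, 0 < ρ → HasOrder ρ A m Q := by
  obtain ⟨A, hA, h⟩ := hQ.exists_norm_le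
  exact ⟨orderConst m * A, mul_nonneg (by unfold orderConst; positivity) hA, fun ρ hρ =>
    hasOrder_of_norm_le hρ hA (hQ.analytic.mono (subset_univ _)) (fun z _ => h z)⟩

lemma exists_small_perturbation {c : ℝ} (hc : 0 < c) (M : ℝ) :
    ∀ᶠ ε in 𝓝 (0 : ℝ), ε ≤ c / 2 ∧ 8 * ε * (2 * c + 4 * (M + ε)) ≤ c ^ 2 := by
  have h1 : ∀ᶠ ε in 𝓝 (0 : ℝ), ε < c / 2 := gt_mem_nhds (half_pos hc)
  have h2 : Filter.Tendsto (fun ε : ℝ => 8 * ε * (2 * c + 4 * (M + ε))) (𝓝 0)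
      (𝓝 (8 * 0 * (2 * c + 4 * (M + 0)))) := Continuous.tendsto (by fun_prop) 0
  have h3 := h2.eventually_lt_const (u := c ^ 2) (by simpa using pow_pos hc 2)
  filter_upwards [h1, h3] with ε h h' using ⟨h.le, h'.le⟩

/-- Local topological triviality of a linear family of nondegenerate homogeneous functions. -/
lemma IsHomogFun.eventually_zeroSetEquiv {P R : En n → ℂ} (hP : IsHomogFun (m + 1) P)
    (hR : IsHomogFun (m + 1) R) (s : ℂ)
    (h0 : ∀ z : En n, z ≠ 0 → fderiv ℂ (fun z => P z + s * R z) z ≠ 0) :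
    ∀ᶠ t in 𝓝 s, ZeroSetEquiv (fun z => P z + s * R z) (fun z => P z + t * R z) := by
  have hQ := hP.add_mul hR s
  obtain ⟨M, hM, hQM⟩ := hQ.hasOrder
  obtain ⟨c, hc, hQc⟩ := hQ.exists_le_norm_fderiv h0
  obtain ⟨A, hA, hRA⟩ := hR.exists_norm_le
  have ht : Filter.Tendsto (fun t : ℂ => orderConst m * (‖t - s‖ * A)) (𝓝 s) (𝓝 0) := by
    have : Continuous (fun t : ℂ => orderConst m * (‖t - s‖ * A)) := by fun_prop
    simpa using this.tendsto s
  filter_upwards [ht.eventually (exists_small_perturbation hc M)] with t ⟨ht1, ht2⟩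
  have hh : HasOrder 1 (orderConst m * (‖t - s‖ * A)) m (fun z => (t - s) * R z) := by
    refine hasOrder_of_norm_le one_pos (by positivity)
      ((analyticOnNhd_const.mul hR.analytic).mono (subset_univ _)) (fun z _ => ?_)
    rw [norm_mul, mul_assoc]
    gcongr
    exact hRA z
  have := zeroSetEquiv_add one_pos (hQM 1 one_pos) hh hc
    (mul_nonneg (by unfold orderConst; positivity) (by positivity)) hM ht1 ht2
    (fun z _ hz => hQc z hz)
  convert this using 2 with z
  ring

/-- A function vanishing to order `m + 1` is a small perturbation of its nondegenerate
initial term. -/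
lemma IsHomogFun.zeroSetEquiv_of_isBigO {P f : En n → ℂ} (hP : IsHomogFun (m + 1) P)
    (h0 : ∀ z : En n, z ≠ 0 → fderiv ℂ P z ≠ 0) (hf : AnalyticAt ℂ f 0)
    (hO : (fun z => f z - P z) =O[𝓝 0] fun z : En n => ‖z‖ ^ (m + 2)) :
    ZeroSetEquiv P f := by
  obtain ⟨M, hM, hPM⟩ := hP.hasOrder
  obtain ⟨c, hc, hPc⟩ := hP.exists_le_norm_fderiv h0
  obtain ⟨C, hC, hO⟩ := hO.exists_nonneg
  have h1 : ∀ᶠ z in 𝓝 (0 : En n), AnalyticAt ℂ f z ∧ ‖f z - P z‖ ≤ C * ‖z‖ ^ (m + 2) := by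
    filter_upwards [hf.eventually_analyticAt, hO.bound] with z hz hz'
    exact ⟨hz, by simpa using hz'⟩
  obtain ⟨r, hr, hball⟩ := Metric.eventually_nhds_iff_ball.1 h1
  have ht : Filter.Tendsto (fun ρ : ℝ => orderConst m * (C * (8 * ρ))) (𝓝[>] 0) (𝓝 0) := by
    have : Continuous (fun ρ : ℝ => orderConst m * (C * (8 * ρ))) := by fun_prop
    have := this.tendsto 0
    simp only [mul_zero] at this
    exact this.mono_left nhdsWithin_le_nhds
  have hsmall : ∀ᶠ ρ : ℝ in 𝓝[>] 0, ρ < r / 8 :=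
    nhdsWithin_le_nhds (gt_mem_nhds (by positivity))
  obtain ⟨ρ, ⟨hρ1, hρ2⟩, hρr, hρ⟩ := ((ht.eventually (exists_small_perturbation hc M)).and
    (hsmall.and self_mem_nhdsWithin)).exists
  have hsub : ball (0 : En n) (8 * ρ) ⊆ ball 0 r := ball_subset_ball (by linarith)
  have hh : HasOrder ρ (orderConst m * (C * (8 * ρ))) m (fun z => f z - P z) := by
    refine hasOrder_of_norm_le hρ (by positivity)
      (fun z hz => (hball z (hsub hz)).1.sub (hP.analytic z (mem_univ _))) (fun z hz => ?_)
    refine (hball z (hsub hz)).2.trans ?_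
    rw [mem_ball_zero_iff] at hz
    rw [pow_succ' ‖z‖ (m + 1), ← mul_assoc]
    gcongr
  have := zeroSetEquiv_add hρ (hPM ρ hρ) hh hc
    (mul_nonneg (by unfold orderConst; positivity) (by positivity)) hM hρ1 hρ2
    (fun z _ hz => hPc z hz)
  simpa using this

end Homogeneous

section Algebra

open MvPolynomial

variable {n : ℕ}

/-- The Nullstellensatz: a family of forms with no common zero other than the origin generates
an ideal containing a power of the irrelevant ideal. -/
lemma exists_pow_idealOfVars_le (g : Fin n → MvPolynomial (Fin n) ℂ)
    (hg : ∀ x : Fin n → ℂ, (∀ i, eval x (g i) = 0) → x = 0) (m : ℕ) :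
    ∃ N, m ≤ N ∧ idealOfVars (Fin n) ℂ ^ N ≤ Ideal.span (range g) := by
  have h : idealOfVars (Fin n) ℂ ≤ (Ideal.span (range g)).radical := by
    rw [← vanishingIdeal_zeroLocus_eq_radical (K := ℂ), idealOfVars, Ideal.span_le]
    rintro _ ⟨i, rfl⟩ x hx
    have : x = 0 := hg x fun j => by
      simpa [coe_aeval_eq_eval] using hx (g j) (Ideal.subset_span (mem_range_self j))
    simp [this]
  obtain ⟨N, hN⟩ := Ideal.exists_pow_le_of_le_radical_of_fg h (idealOfVars_fg _ _)
  exact ⟨max m N, le_max_left _ _, (Ideal.pow_le_pow_right (le_max_right _ _)).trans hN⟩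

lemma exists_homogeneous_coeffs {g : Fin n → MvPolynomial (Fin n) ℂ} {m N : ℕ}
    (hg : ∀ i, (g i).IsHomogeneous m) (hmN : m ≤ N) {p : MvPolynomial (Fin n) ℂ}
    (hp : p.IsHomogeneous N) (hpg : p ∈ Ideal.span (range g)) :
    ∃ b : Fin n → MvPolynomial (Fin n) ℂ,
      (∀ i, (b i).IsHomogeneous (N - m)) ∧ p = ∑ i, b i * g i := by
  obtain ⟨a, ha⟩ := Ideal.mem_span_range_iff_exists_fun.1 hpg
  refine ⟨fun i => homogeneousComponent (N - m) (a i),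
    fun i => homogeneousComponent_isHomogeneous _ _, ?_⟩
  let := gradedAlgebra (σ := Fin n) (R := ℂ)
  have key : ∀ i, homogeneousComponent N (a i * g i)
      = homogeneousComponent (N - m) (a i) * g i := fun i => by
    have := DirectSum.coe_decompose_mul_of_right_mem_of_le
      (homogeneousSubmodule (Fin n) ℂ) (a := a i) (b := g i) (i := m) (n := N) (hg i) hmN
    rwa [← DirectSum.Decomposition.decompose'_eq, decomposition.decompose'_apply,
      decomposition.decompose'_apply] at this
  rw [← homogeneousComponent_eq_self hp, ← ha, map_sum]
  exact Finset.sum_congr rfl fun i _ => key i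

lemma eval_eq_sum_of_support_subset {p : MvPolynomial (Fin n) ℂ} {S : Finset (Fin n →₀ ℕ)}
    (hS : p.support ⊆ S) (x : Fin n → ℂ) :
    eval x p = ∑ γ : S, coeff γ.1 p * eval x (monomial γ.1 (1 : ℂ)) := by
  rw [Finset.sum_coe_sort S (fun γ => coeff γ p * eval x (monomial γ (1 : ℂ)))]
  conv_lhs => rw [p.as_sum, map_sum]
  rw [← Finset.sum_subset hS (fun γ _ hγ => by rw [notMem_support_iff.1 hγ, zero_mul])]
  exact Finset.sum_congr rfl fun γ _ => by simp [eval_monomial]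

/-- In a pencil of systems of forms, one of which is nondegenerate, only finitely many are
degenerate. -/
lemma finite_degenerate {g h : Fin n → MvPolynomial (Fin n) ℂ} {m : ℕ}
    (hg : ∀ i, (g i).IsHomogeneous m) (hh : ∀ i, (h i).IsHomogeneous m)
    (hg0 : ∀ x : Fin n → ℂ, (∀ i, eval x (g i) = 0) → x = 0) :
    {t : ℂ | ∃ x : Fin n → ℂ, x ≠ 0 ∧ ∀ i, eval x (g i) + t * eval x (h i) = 0}.Finite := by
  obtain ⟨N, hmN, hN⟩ := exists_pow_idealOfVars_le g hg0 m
  have hfin : {β : Fin n →₀ ℕ | β.degree = N}.Finite :=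
    (Finsupp.finite_of_degree_le N).subset fun β hβ => (show β.degree = N from hβ).le
  set S : Finset (Fin n →₀ ℕ) := hfin.toFinset with hSdef
  have hS : ∀ β, β ∈ S ↔ β.degree = N := fun β => by simp [hSdef]
  have hsupp : ∀ {p : MvPolynomial (Fin n) ℂ}, p.IsHomogeneous N → p.support ⊆ S :=
    fun hp β hβ => by
      rw [hS]
      by_contra hd
      exact (mem_support_iff.1 hβ) (hp.coeff_eq_zero hd)
  have hb : ∀ β : S, ∃ b : Fin n → MvPolynomial (Fin n) ℂ,
      (∀ i, (b i).IsHomogeneous (N - m)) ∧ monomial β.1 (1 : ℂ) = ∑ i, b i * g i := fun β =>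
    exists_homogeneous_coeffs hg hmN (isHomogeneous_monomial 1 ((hS _).1 β.2))
      (hN ((monomial_mem_pow_idealOfVars_iff N β.1 one_ne_zero).2 ((hS _).1 β.2).ge))
  choose b hbh hb using hb
  let D : Matrix S S ℂ := fun β γ => coeff γ.1 (∑ i, b β i * h i)
  have hD : ∀ (x : Fin n → ℂ) (β : S), ∑ i, eval x (b β i) * eval x (h i)
      = ∑ γ, D β γ * eval x (monomial γ.1 (1 : ℂ)) := fun x β => by
    rw [← eval_eq_sum_of_support_subset (hsupp ?_) x, map_sum]
    · simp only [map_mul]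
    · refine IsHomogeneous.sum _ _ _ fun i _ => ?_
      simpa [Nat.sub_add_cancel hmN] using (hbh β i).mul (hh i)
  refine ((Module.End.finite_hasEigenvalue (Matrix.toLin' D)).preimage
    ((inv_injective.comp neg_injective).injOn)).subset ?_
  rintro t ⟨x, hx, ht⟩
  let u : S → ℂ := fun β => eval x (monomial β.1 (1 : ℂ))
  have hu : u = (-t) • D.mulVec u := by
    ext β
    have h1 : u β = ∑ i, eval x (b β i) * eval x (g i) := by
      simp only [u, hb, map_sum, map_mul]
    rw [h1, Pi.smul_apply, Matrix.mulVec, dotProduct, ← hD x β, smul_eq_mul, Finset.mul_sum]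
    refine Finset.sum_congr rfl fun i _ => ?_
    rw [eq_neg_of_add_eq_zero_left (ht i)]
    ring
  have hu0 : u ≠ 0 := by
    obtain ⟨i, hi⟩ := Function.ne_iff.1 hx
    intro h0
    have := congrFun h0 ⟨Finsupp.single i N, (hS _).2 (by simp)⟩
    simp only [u, eval_monomial, one_mul, Pi.zero_apply] at this
    rw [Finsupp.prod_single_index (h := fun j e => x j ^ e) (pow_zero _)] at this
    exact hi (eq_zero_of_pow_eq_zero this)
  have ht0 : -t ≠ 0 := by
    intro h0
    rw [h0, zero_smul] at hu
    exact hu0 hu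
  refine Module.End.hasEigenvalue_of_hasEigenvector (x := u)
    ⟨Module.End.mem_eigenspace_iff.2 ?_, hu0⟩
  rw [Matrix.toLin'_apply]
  conv_rhs => rw [hu]
  rw [smul_smul, Function.comp_apply, inv_mul_cancel₀ ht0, one_smul]

/-- The diagonal of a multilinear form is given by a homogeneous polynomial. -/
lemma exists_isHomogeneous_eq_diag {k : ℕ} (p : (En n) [×k]→L[ℂ] ℂ) :
    ∃ q : MvPolynomial (Fin n) ℂ, q.IsHomogeneous k ∧ ∀ z : En n, evalE q z = p fun _ => z := by
  refine ⟨∑ r : Fin k → Fin n, C (p fun j => EuclideanSpace.single (r j) 1) * ∏ j, X (r j),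
    IsHomogeneous.sum _ _ _ fun r _ => IsHomogeneous.C_mul ?_ _, fun z => ?_⟩
  · simpa using IsHomogeneous.prod Finset.univ (fun j => (X (r j) : MvPolynomial (Fin n) ℂ))
      (fun _ => 1) (fun j _ => isHomogeneous_X _ _)
  · have hz : z = ∑ i, z i • EuclideanSpace.single i (1 : ℂ) := by
      ext j
      simp [Pi.single_apply]
    conv_rhs => rw [hz]
    rw [ContinuousMultilinearMap.map_sum]
    simp only [evalE, map_sum, map_mul, map_prod, eval_C, eval_X]
    refine Finset.sum_congr rfl fun r _ => ?_
    rw [ContinuousMultilinearMap.map_smul_univ p (fun j => z (r j))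
      (fun j => EuclideanSpace.single (r j) (1 : ℂ)), smul_eq_mul, mul_comm]

lemma hasFDerivAt_evalE (q : MvPolynomial (Fin n) ℂ) (z : En n) :
    HasFDerivAt (𝕜 := ℂ) (evalE q)
      (∑ i, evalE (pderiv i q) z • (EuclideanSpace.proj i : En n →L[ℂ] ℂ)) z := by
  induction q using MvPolynomial.induction_on with
  | C a =>
    have h1 : evalE (C a : MvPolynomial (Fin n) ℂ) = fun _ => a := by ext; simp [evalE]
    rw [h1]
    refine (hasFDerivAt_const a z).congr_fderiv ?_
    ext w
    simp [evalE]
  | add p q hp hq =>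
    have h1 : evalE (p + q) = fun z => evalE p z + evalE q z := by ext; simp [evalE]
    rw [h1]
    refine (hp.fun_add hq).congr_fderiv ?_
    ext w
    simp [evalE, add_mul, Finset.sum_add_distrib]
  | mul_X p j hp =>
    have h1 : evalE (p * X j) = fun z => evalE p z * (EuclideanSpace.proj j : En n →L[ℂ] ℂ) z := by
      ext; simp [evalE]
    rw [h1]
    refine (hp.mul (EuclideanSpace.proj j : En n →L[ℂ] ℂ).hasFDerivAt).congr_fderiv ?_
    ext w
    simp [evalE, pderiv_X, Pi.single_apply, add_mul, Finset.sum_add_distrib, Finset.mul_sum,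
      mul_assoc, apply_ite (eval _)]

lemma fderiv_evalE_eq_zero_iff (q : MvPolynomial (Fin n) ℂ) (z : En n) :
    fderiv ℂ (evalE q) z = 0 ↔ ∀ i, eval (fun i => z i) (pderiv i q) = 0 := by
  rw [(hasFDerivAt_evalE q z).fderiv]
  constructor
  · intro h i
    have := congrArg (fun l : En n →L[ℂ] ℂ => l (EuclideanSpace.single i 1)) h
    simpa [evalE, Pi.single_apply] using this
  · intro h
    ext w
    simp [evalE, h]

end Algebra

section Pencil

open MvPolynomial

variable {n m : ℕ}

lemma isHomogFun_evalE {d : ℕ} {q : MvPolynomial (Fin n) ℂ} (hq : q.IsHomogeneous d) :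
    IsHomogFun d (evalE q) where
  analytic := by
    have h1 : evalE q = fun z : En n => aeval (fun i => z i) q := by
      ext
      simp [evalE]
    rw [h1]
    exact AnalyticOnNhd.aeval_mvPolynomial
      (fun i => (EuclideanSpace.proj i : En n →L[ℂ] ℂ).analyticOnNhd univ) q
  map_smul r z := by
    simp only [evalE, eval_eq, PiLp.smul_apply, smul_eq_mul, Finset.mul_sum]
    refine Finset.sum_congr rfl fun β hβ => ?_
    have hd : d = ∑ i ∈ β.support, β i := hq.degree_eq_sum_deg_support hβ
    simp only [mul_pow, Finset.prod_mul_distrib, Finset.prod_pow_eq_pow_sum, ← hd]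
    ring

lemma fderiv_pencil_eq_zero_iff (p q : MvPolynomial (Fin n) ℂ) (t : ℂ) (z : En n) :
    fderiv ℂ (fun z => evalE p z + t * evalE q z) z = 0 ↔
      ∀ i, eval (fun i => z i) (pderiv i p) + t * eval (fun i => z i) (pderiv i q) = 0 := by
  have : (fun z => evalE p z + t * evalE q z) = evalE (p + C t * q) := by
    ext
    simp [evalE]
  rw [this, fderiv_evalE_eq_zero_iff]
  simp

/-- Any two nondegenerate forms of the same degree have equivalent zero sets. -/
lemma zeroSetEquiv_of_nondegenerate {p q : MvPolynomial (Fin n) ℂ}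
    (hp : p.IsHomogeneous (m + 1)) (hq : q.IsHomogeneous (m + 1))
    (hp0 : ∀ z : En n, fderiv ℂ (evalE p) z = 0 → z = 0)
    (hq0 : ∀ z : En n, z ≠ 0 → fderiv ℂ (evalE q) z ≠ 0) :
    ZeroSetEquiv (evalE p) (evalE q) := by
  have hr : (q - p).IsHomogeneous (m + 1) := hq.sub hp
  set B : Set ℂ := {t | ∃ x : Fin n → ℂ, x ≠ 0 ∧
    ∀ i, eval x (pderiv i p) + t * eval x (pderiv i (q - p)) = 0} with hB
  have hBfin : B.Finite := finite_degenerate (m := m) (fun i => hp.pderiv) (fun i => hr.pderiv)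
    fun x hx => by
      have := hp0 (WithLp.toLp 2 x) ((fderiv_evalE_eq_zero_iff _ _).2 hx)
      simpa using this
  have hcon : IsPreconnected Bᶜ :=
    (hBfin.countable.isConnected_compl_of_one_lt_rank (by simp)).isPreconnected
  have hnd : ∀ t ∈ Bᶜ, ∀ z : En n, z ≠ 0 →
      fderiv ℂ (fun z => evalE p z + t * evalE (q - p) z) z ≠ 0 := fun t ht z hz h0 =>
    ht ⟨fun i => z i, fun h => hz (PiLp.ext fun i => congrFun h i),
      (fderiv_pencil_eq_zero_iff _ _ _ _).1 h0⟩
  have hB0 : (0 : ℂ) ∈ Bᶜ := by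
    rintro ⟨x, hx, h⟩
    refine hx ?_
    have := hp0 (WithLp.toLp 2 x) ((fderiv_evalE_eq_zero_iff _ _).2 (by simpa using h))
    simpa using this
  have hB1 : (1 : ℂ) ∈ Bᶜ := by
    rintro ⟨x, hx, h⟩
    refine hq0 (WithLp.toLp 2 x) (by simpa using hx) ((fderiv_evalE_eq_zero_iff _ _).2 fun i => ?_)
    simpa using h i
  have := hcon.induction₂ (fun s t => ZeroSetEquiv (fun z => evalE p z + s * evalE (q - p) z)
      (fun z => evalE p z + t * evalE (q - p) z))
    (fun s hs => nhdsWithin_le_nhds ((isHomogFun_evalE hp).eventually_zeroSetEquiv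
      (isHomogFun_evalE hr) s (hnd s hs)))
    (fun _ _ _ _ _ _ => ZeroSetEquiv.trans) (fun _ _ _ _ => ZeroSetEquiv.symm) hB0 hB1
  have h0 : (fun z => evalE p z + 0 * evalE (q - p) z) = evalE p := by ext; simp
  have h1 : (fun z => evalE p z + 1 * evalE (q - p) z) = evalE q := by ext; simp [evalE]
  rwa [h0, h1] at this

lemma evalE_fermat (k : ℕ) :
    evalE (∑ i, X i ^ k : MvPolynomial (Fin n) ℂ) = fun z : En n => ∑ i, (z i) ^ k := by
  ext
  simp [evalE]

lemma fderiv_fermat_ne_zero {z : En n} (hz : z ≠ 0) :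
    fderiv ℂ (evalE (∑ i, X i ^ (m + 1) : MvPolynomial (Fin n) ℂ)) z ≠ 0 := by
  intro h
  rw [fderiv_evalE_eq_zero_iff] at h
  refine hz (PiLp.ext fun i => ?_)
  have := h i
  simp [pderiv_X, Pi.single_apply, Nat.cast_add_one_ne_zero] at this
  exact this.1

lemma isBigO_sub_initialTerm {f P : En n → ℂ} {k : ℕ}
    {p : FormalMultilinearSeries ℂ (En n) ℂ} (hp : HasFPowerSeriesAt f p 0)
    (hlow : ∀ j < k, ∀ z : En n, (p j fun _ => z) = 0) (hP : ∀ z : En n, P z = p k fun _ => z) :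
    (fun z => f z - P z) =O[𝓝 0] fun z : En n => ‖z‖ ^ (k + 1) := by
  have := hp.isBigO_sub_partialSum_pow (k + 1)
  refine this.congr_left fun z => ?_
  rw [FormalMultilinearSeries.partialSum, Finset.sum_range_succ, zero_add, hP,
    Finset.sum_eq_zero fun j hj => hlow j (Finset.mem_range.1 hj) z, zero_add]

end Pencil

theorem equisingular_to_fermat {n : ℕ} (hn : n ≠ 3)
    (f : En n → ℂ) (hf : AnalyticAt ℂ f 0) (hf0 : f 0 = 0)
    -- `f` has algebraic multiplicity `k` with initial homogeneous term `P`
    (k : ℕ) (P : En n → ℂ) (hfi : HasInitialTerm f k P)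
    -- the partial derivatives of `P` have no common zero other than `0`
    (hP : ∀ z : En n, fderiv ℂ P z = 0 → z = 0) :
    TopEquisingular f (fun z : En n => ∑ i, (z i) ^ k) := by
  obtain ⟨p, hp, hlow, hPp, hP0⟩ := hfi
  obtain _ | m := k
  · refine absurd (funext fun z => ?_) hP0
    rw [hPp, hp.coeff_zero, hf0, Pi.zero_apply]
  obtain ⟨q, hq, hqP⟩ := exists_isHomogeneous_eq_diag (p (m + 1))
  obtain rfl : evalE q = P := funext fun z => (hqP z).trans (hPp z).symm
  have h1 : ZeroSetEquiv (evalE q) f := (isHomogFun_evalE hq).zeroSetEquiv_of_isBigO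
    (fun z hz h => hz (hP z h)) hf (isBigO_sub_initialTerm hp hlow hPp)
  have h2 := zeroSetEquiv_of_nondegenerate hq
    (q := ∑ i, MvPolynomial.X i ^ (m + 1))
    (MvPolynomial.IsHomogeneous.sum _ _ _ fun i _ => MvPolynomial.isHomogeneous_X_pow i _)
    hP (fun z hz => fderiv_fermat_ne_zero hz)
  rw [evalE_fermat] at h2
  exact (h1.symm.trans h2).topEquisingular
end
end

section
/- Let k ≥ 2 and let P ∈ ℂ[z₁,…,z_n] be a homogeneous polynomial of degree k whose partial derivatives ∂P/∂z₁,…,∂P/∂z_n have no common zero in ℂ^n other than the origin. Then there exists a nonzero complex number α such that for every t ∈ [0,1], the polynomial F_t(z) = (1−t)(z₁^k + ⋯ + z_n^k) + tαP(z) has the origin as an isolated singularity, i.e. the partial derivatives of F_t have no common zero other than 0. -/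
open scoped Topology

set_option synthInstance.maxHeartbeats 1000000
set_option maxHeartbeats 1000000

noncomputable section

open MvPolynomial in
/-- The numbers `μ` for which the homogeneous system `μ * z i ^ d = p i z` of forms of the same
degree `d` has a nontrivial solution are finitely many. -/
theorem finite_setOf_exists_mul_pow_eq_eval {σ K : Type*} [Fintype σ] [Field K] (d : ℕ)
    (p : σ → MvPolynomial σ K) (hp : ∀ i, (p i).IsHomogeneous d) :
    {μ : K | ∃ z : σ → K, z ≠ 0 ∧ ∀ i, μ * z i ^ d = eval z (p i)}.Finite := by
  classical
  set N : ℕ := Fintype.card σ * d + 1 with hN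
  let M : Finset (σ →₀ ℕ) := Finset.univ.finsuppAntidiag N
  have mem_M (m : σ →₀ ℕ) : m ∈ M ↔ m.degree = N := by
    simp [M, Finset.mem_finsuppAntidiag, Finsupp.degree_eq_sum]
  have exists_le (m : M) : ∃ i, d ≤ (m : σ →₀ ℕ) i := by
    by_contra! h
    have hm := (mem_M m).1 m.2
    rw [Finsupp.degree_eq_sum] at hm
    have := Finset.sum_le_card_nsmul Finset.univ (fun j => (m : σ →₀ ℕ) j) d fun j _ => (h j).le
    rw [smul_eq_mul, Finset.card_univ] at this
    omega
  choose i hi using exists_le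
  have single_le (m : M) : Finsupp.single (i m) d ≤ (m : σ →₀ ℕ) := by
    simpa using hi m
  let q (m : M) : MvPolynomial σ K := monomial ((m : σ →₀ ℕ) - Finsupp.single (i m) d) 1 * p (i m)
  have hq (m : M) : (q m).IsHomogeneous N := by
    have h := (isHomogeneous_monomial (1 : K)
      (rfl : ((m : σ →₀ ℕ) - Finsupp.single (i m) d).degree = _)).mul (hp (i m))
    convert h using 1
    have := congrArg Finsupp.degree (tsub_add_cancel_of_le (single_le m))
    rw [map_add, Finsupp.degree_single, (mem_M m).1 m.2] at this
    exact this.symm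
  let A : Matrix M M K := Matrix.of fun m m' => coeff (m' : σ →₀ ℕ) (q m)
  refine (Module.End.finite_hasEigenvalue (Matrix.toLin' A)).subset ?_
  rintro μ ⟨z, hz, h⟩
  let v : M → K := fun m => ∏ j, z j ^ (m : σ →₀ ℕ) j
  have hv : v ≠ 0 := by
    obtain ⟨j, hj⟩ := Function.ne_iff.1 hz
    refine Function.ne_iff.2 ⟨⟨Finsupp.single j N, (mem_M _).2 (by simp)⟩, ?_⟩
    refine Finset.prod_ne_zero_iff.2 fun l _ => ?_
    rcases eq_or_ne l j with rfl | hl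
    · exact pow_ne_zero _ hj
    · simp [Finsupp.single_eq_of_ne hl]
  have eval_q (m : M) : eval z (q m) = μ * v m := by
    have hm : v m = eval z (monomial (m : σ →₀ ℕ) 1) := by
      simp [v, eval_monomial, Finsupp.prod_fintype]
    rw [hm, ← tsub_add_cancel_of_le (single_le m), ← mul_one (1 : K), ← monomial_mul, map_mul,
      map_mul, ← h (i m)]
    simp only [eval_monomial (s := Finsupp.single _ _), one_mul]
    rw [Finsupp.prod_single_index (by simp)]
    ring
  refine Module.End.hasEigenvalue_of_hasEigenvector (x := v)
    ⟨Module.End.mem_eigenspace_iff.2 (funext fun m => ?_), hv⟩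
  rw [Matrix.toLin'_apply, Pi.smul_apply, smul_eq_mul, ← eval_q, eval_eq']
  have hsub : (q m).support ⊆ M := fun m' hm' =>
    (mem_M m').2 <|
      (DFunLike.congr_fun Finsupp.degree_eq_weight_one m').trans (hq m (mem_support_iff.1 hm'))
  rw [Finset.sum_subset hsub fun m' _ hm' => by simp [notMem_support_iff.1 hm'],
    ← Finset.sum_coe_sort M]
  rfl

theorem claim_isolated_deformation {n : ℕ} (k : ℕ) (hk : 2 ≤ k)
    (P : MvPolynomial (Fin n) ℂ) (hP : P.IsHomogeneous k)
    (hPsing : ∀ z : Fin n → ℂ,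
      (∀ i, MvPolynomial.eval z (MvPolynomial.pderiv i P) = 0) → z = 0) :
    ∃ α : ℂ, α ≠ 0 ∧ ∀ t : ℝ, t ∈ Set.Icc (0:ℝ) 1 → ∀ z : Fin n → ℂ,
      (∀ i, MvPolynomial.eval z (MvPolynomial.pderiv i
        (MvPolynomial.C (1 - (t:ℂ)) * (∑ j, MvPolynomial.X j ^ k) +
          MvPolynomial.C ((t:ℂ) * α) * P)) = 0) → z = 0 := by
  have hk0 : (k : ℂ) ≠ 0 := by exact_mod_cast (by omega : k ≠ 0)
  have hd : k - 1 ≠ 0 := by omega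
  have hfin := finite_setOf_exists_mul_pow_eq_eval (k - 1)
    (fun i => MvPolynomial.pderiv i P) fun i => hP.pderiv
  obtain ⟨s, hs⟩ := (hfin.image fun μ : ℂ => μ.im / μ.re).exists_notMem
  have hβ : (⟨1, s⟩ : ℂ) ≠ 0 := fun h => one_ne_zero (congrArg Complex.re h)
  refine ⟨(⟨1, s⟩ : ℂ)⁻¹, inv_ne_zero hβ, fun t ht z hz => ?_⟩
  have key (i : Fin n) : (1 - (t : ℂ)) * (k * z i ^ (k - 1)) +
      t * (⟨1, s⟩ : ℂ)⁻¹ * MvPolynomial.eval z (MvPolynomial.pderiv i P) = 0 := by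
    simpa [MvPolynomial.pderiv_X, Derivation.leibniz_pow, Pi.single_apply] using hz i
  rcases eq_or_ne t 0 with rfl | ht0
  · funext i
    simpa [hk0, hd] using key i
  rcases eq_or_ne t 1 with rfl | ht1
  · exact hPsing z fun i => by simpa [hβ] using key i
  have htc : (t : ℂ) ≠ 0 := by exact_mod_cast ht0
  by_contra hz0
  have hpos : 0 < (1 - t) * k / t := by
    have := lt_of_le_of_ne ht.2 ht1
    have := lt_of_le_of_ne ht.1 ht0.symm
    have : (0 : ℝ) < k := by exact_mod_cast (by omega : 0 < k)
    exact div_pos (mul_pos (by linarith) this) (by assumption)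
  refine hs ⟨(-((1 - t) * k / t) : ℝ) * (⟨1, s⟩ : ℂ), ⟨z, hz0, fun i => ?_⟩, ?_⟩
  · have h := key i
    field_simp at h
    push_cast
    field_simp
    linear_combination -h
  · simp only [Complex.re_ofReal_mul, Complex.im_ofReal_mul, mul_one]
    exact mul_div_cancel_left₀ s (neg_ne_zero.2 hpos.ne')
end
end
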